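/- Let n ≥ 2, let k be a natural number with k > 0, and let μ be a continuous, translation invariant, U(n)-invariant valuation on ℂⁿ that is homogeneous of degree k. Then for all convex bodies K, L ⊆ ℂⁿ: ∫_{SU(n)} ∫_{ℂⁿ} μ̃(K ∩ (gL + x)) dx dg = ∫_{U(n)} ∫_{ℂⁿ} μ̃(K ∩ (gL + x)) dx dg. -/

import Mathlib

open MeasureTheory
open scoped ENNReal

noncomputable section

/-- `ℂⁿ`, regarded as a real inner product space via `Re⟨z,w⟫`. -/
abbrev Cn (n : ℕ) := EuclideanSpace ℂ (Fin n)

/-- `μ` is a valuation: it is finitely additive on convex bodies of `ℂⁿ`. -/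
def IsValuation {n : ℕ} (μ : ConvexBody (Cn n) → ℂ) : Prop :=
  ∀ K L U I : ConvexBody (Cn n),
    (U : Set (Cn n)) = (K : Set (Cn n)) ∪ (L : Set (Cn n)) →
    (I : Set (Cn n)) = (K : Set (Cn n)) ∩ (L : Set (Cn n)) →
    μ U + μ I = μ K + μ L

/-- `μ` is translation invariant. -/
def TranslationInvariant {n : ℕ} (μ : ConvexBody (Cn n) → ℂ) : Prop :=
  ∀ (x : Cn n) (K L : ConvexBody (Cn n)),
    (L : Set (Cn n)) = (fun y => x + y) '' (K : Set (Cn n)) → μ L = μ K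

/-- `μ` is invariant under the unitary group `U(n)` acting on `ℂⁿ`. -/
def UInvariant {n : ℕ} (μ : ConvexBody (Cn n) → ℂ) : Prop :=
  ∀ g ∈ Matrix.unitaryGroup (Fin n) ℂ, ∀ K L : ConvexBody (Cn n),
    (L : Set (Cn n)) = (Matrix.toEuclideanLin g) '' (K : Set (Cn n)) → μ L = μ K

/-- `μ` is homogeneous of degree `k` : `μ (t K) = t ^ k * μ K` for `t > 0`. -/
def Homogeneous {n : ℕ} (k : ℕ) (μ : ConvexBody (Cn n) → ℂ) : Prop :=
  ∀ (t : ℝ), 0 < t → ∀ K L : ConvexBody (Cn n),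
    (L : Set (Cn n)) = (fun y => t • y) '' (K : Set (Cn n)) → μ L = (t : ℂ) ^ k * μ K

instance (n : ℕ) : MeasurableSpace (Cn n) := borel _
instance (n : ℕ) : BorelSpace (Cn n) := ⟨rfl⟩

/-- The special unitary group `SU(n)`, as a subgroup of the unitary group. -/
def SUgrp (n : ℕ) : Subgroup ↥(Matrix.unitaryGroup (Fin n) ℂ) where
  carrier := {g | Matrix.det (g : Matrix (Fin n) (Fin n) ℂ) = 1}
  one_mem' := by simp
  mul_mem' := by
    intro a b ha hb
    simp only [Set.mem_setOf_eq, Matrix.UnitaryGroup.mul_val, Matrix.det_mul] at *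
    rw [ha, hb, mul_one]
  inv_mem' := by
    intro a ha
    simp only [Set.mem_setOf_eq, Matrix.UnitaryGroup.inv_val] at *
    rw [Matrix.star_eq_conjTranspose, Matrix.det_conjTranspose, ha, star_one]

instance (n : ℕ) : MeasurableSpace ↥(Matrix.unitaryGroup (Fin n) ℂ) := borel _
instance (n : ℕ) : MeasurableSpace ↥(SUgrp n) := borel _

/-- The action of a unitary matrix on `ℂⁿ`. -/
def actU {n : ℕ} (g : ↥(Matrix.unitaryGroup (Fin n) ℂ)) : Cn n → Cn n :=
  Matrix.toEuclideanLin (g : Matrix (Fin n) (Fin n) ℂ)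

/-- The action of an element of `SU(n)` on `ℂⁿ`. -/
def actSU {n : ℕ} (g : ↥(SUgrp n)) : Cn n → Cn n :=
  actU (g : ↥(Matrix.unitaryGroup (Fin n) ℂ))

open Classical in
/-- The extension of `μ` by `0` to arbitrary subsets of `ℂⁿ` : `μ̃ S = μ S` if `S` is a
convex body and `μ̃ S = 0` otherwise (in particular `μ̃ ∅ = 0`). -/
def extendVal {n : ℕ} (μ : ConvexBody (Cn n) → ℂ) (S : Set (Cn n)) : ℂ :=
  if h : Convex ℝ S ∧ IsCompact S ∧ S.Nonempty then μ ⟨S, h.1, h.2.1, h.2.2⟩ else 0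

/-- The Lebesgue volume of a convex body of `ℂⁿ`, as a complex number. -/
def volC {n : ℕ} (K : ConvexBody (Cn n)) : ℂ := ((volume (K : Set (Cn n))).toReal : ℂ)

section Proof

open TopologicalSpace Filter Topology

section ConvexBodies

variable {E : Type*} [NormedAddCommGroup E] [NormedSpace ℝ E]

/-- The nonempty compact set underlying a convex body. -/
def ConvexBody.toNonemptyCompacts (K : ConvexBody E) : NonemptyCompacts E :=
  ⟨⟨K, K.isCompact⟩, K.nonempty⟩

lemma ConvexBody.isometry_toNonemptyCompacts :
    Isometry (ConvexBody.toNonemptyCompacts : ConvexBody E → NonemptyCompacts E) :=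
  Isometry.of_dist_eq fun K L => by
    rw [Metric.NonemptyCompacts.dist_eq, ← ConvexBody.hausdorffDist_coe]; rfl

instance [SecondCountableTopology E] : SecondCountableTopology (ConvexBody E) :=
  ConvexBody.isometry_toNonemptyCompacts.isUniformInducing.isInducing.secondCountableTopology

lemma isClosed_convex_nonemptyCompacts :
    IsClosed {K : NonemptyCompacts E | Convex ℝ (K : Set E)} := by
  rw [← isOpen_compl_iff, isOpen_iff_mem_nhds]
  intro A hA
  have hA' : ¬ Convex ℝ (A : Set E) := hA
  simp only [Convex, StarConvex] at hA'
  push Not at hA'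
  obtain ⟨x, hx, y, hy, a, b, ha, hb, hab, hz⟩ := hA'
  have hcl : IsClosed (A : Set E) := A.isCompact.isClosed
  obtain ⟨δ, hδ, hball⟩ := Metric.isOpen_iff.1 hcl.isOpen_compl _ hz
  have h1 := (NonemptyCompacts.isOpen_inter_nonempty_of_isOpen
    (Metric.isOpen_ball (x := x) (ε := δ / 2))).mem_nhds (x := A)
    ⟨x, hx, Metric.mem_ball_self (by positivity)⟩
  have h2 := (NonemptyCompacts.isOpen_inter_nonempty_of_isOpen
    (Metric.isOpen_ball (x := y) (ε := δ / 2))).mem_nhds (x := A)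
    ⟨y, hy, Metric.mem_ball_self (by positivity)⟩
  have h3 := (NonemptyCompacts.isOpen_subsets_of_isOpen
    (Metric.isClosed_closedBall (x := a • x + b • y) (ε := δ / 2)).isOpen_compl).mem_nhds (x := A)
    (fun w hw hw' => hball (Metric.closedBall_subset_ball (by linarith) hw') hw)
  filter_upwards [h1, h2, h3] with B ⟨x', hx', hxx⟩ ⟨y', hy', hyy⟩ hB hconv
  have hz' := (show Convex ℝ (B : Set E) from hconv) hx' hy' ha hb hab
  refine hB hz' ?_
  rw [mem_ball_iff_norm] at hxx hyy
  rw [mem_closedBall_iff_norm,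
    show a • x' + b • y' - (a • x + b • y) = a • (x' - x) + b • (y' - y) by module]
  calc ‖a • (x' - x) + b • (y' - y)‖ ≤ a * ‖x' - x‖ + b * ‖y' - y‖ := by
        refine (norm_add_le _ _).trans ?_
        rw [norm_smul, norm_smul, Real.norm_of_nonneg ha, Real.norm_of_nonneg hb]
    _ ≤ a * (δ / 2) + b * (δ / 2) := by gcongr
    _ = δ / 2 := by rw [← add_mul, hab, one_mul]

lemma ConvexBody.isCompact_subsets_of_isCompact {C : Set E} (hC : IsCompact C) :
    IsCompact {K : ConvexBody E | (K : Set E) ⊆ C} := by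
  rw [ConvexBody.isometry_toNonemptyCompacts.isUniformInducing.isInducing.isCompact_iff]
  have key : ConvexBody.toNonemptyCompacts '' {K : ConvexBody E | (K : Set E) ⊆ C} =
      {K : NonemptyCompacts E | (K : Set E) ⊆ C} ∩ {K | Convex ℝ (K : Set E)} := by
    refine Set.ext fun A => ⟨?_, ?_⟩
    · rintro ⟨K, hK, rfl⟩
      exact ⟨hK, K.convex⟩
    · rintro ⟨hA, hconv⟩
      exact ⟨⟨A, hconv, A.isCompact, A.nonempty⟩, hA, rfl⟩
  rw [key]
  exact (NonemptyCompacts.isCompact_subsets_of_isCompact hC).inter_right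
    isClosed_convex_nonemptyCompacts

lemma ConvexBody.tendsto_of_antitone {K : ℕ → ConvexBody E} {L : ConvexBody E}
    (hK : Antitone fun i => (K i : Set E)) (hL : (L : Set E) = ⋂ i, (K i : Set E)) :
    Tendsto K atTop (𝓝 L) := by
  rw [ConvexBody.isometry_toNonemptyCompacts.isUniformInducing.isInducing.tendsto_nhds_iff]
  rw [NonemptyCompacts.isTopologicalBasis.nhds_hasBasis.tendsto_right_iff]
  rintro _ ⟨⟨u, ⟨-, -, hopen⟩, rfl⟩, hLu⟩
  have hLK (i : ℕ) : (L : Set E) ⊆ K i := hL ▸ Set.iInter_subset _ i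
  obtain ⟨i, hi⟩ := exists_subset_nhds_of_isCompact (V := fun i => (K i : Set E))
    hK.directed_ge (fun i => (K i).isCompact) (U := ⋃₀ u) (fun x hx =>
      (isOpen_sUnion hopen).mem_nhds (hLu.1 (hL ▸ hx)))
  filter_upwards [eventually_ge_atTop i] with j hj
  refine ⟨(hK hj).trans hi, fun U hU => ?_⟩
  obtain ⟨x, hx, hxU⟩ := hLu.2 U hU
  exact ⟨x, hLK j hx, hxU⟩

lemma measurable_convexBody_of_isClosed_graph [SecondCountableTopology E]
    {X : Type*} [TopologicalSpace X] [MeasurableSpace X] [OpensMeasurableSpace X]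
    {C : Set E} (hC : IsCompact C) (T : X → ConvexBody E) (hT : ∀ p, (T p : Set E) ⊆ C)
    (hgraph : IsClosed {p : X × E | p.2 ∈ T p.1}) :
    Measurable[_, borel (ConvexBody E)] T := by
  have hclosed (F : Set E) (hF : IsClosed F) : IsClosed {p | ((T p : Set E) ∩ F).Nonempty} := by
    have : CompactSpace C := isCompact_iff_compactSpace.1 hC
    have h1 : IsClosed {p : X × C | (p.2 : E) ∈ T p.1 ∧ (p.2 : E) ∈ F} :=
      (hgraph.preimage (f := fun p : X × C => (p.1, (p.2 : E))) (by fun_prop)).inter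
        (hF.preimage (f := fun p : X × C => (p.2 : E)) (by fun_prop))
    convert isClosedMap_fst_of_compactSpace _ h1 using 1
    ext p
    constructor
    · rintro ⟨x, hx, hxF⟩
      exact ⟨(p, ⟨x, hT p hx⟩), ⟨hx, hxF⟩, rfl⟩
    · rintro ⟨⟨q, x⟩, ⟨hx, hxF⟩, rfl⟩
      exact ⟨x, hx, hxF⟩
  have hopen (U : Set E) (hU : IsOpen U) : MeasurableSet {p | ((T p : Set E) ∩ U).Nonempty} := by
    obtain ⟨F, hF, -, rfl, -⟩ := hU.exists_iUnion_isClosed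
    simp only [Set.inter_iUnion, Set.nonempty_iUnion]
    rw [Set.ofPred_exists]
    exact MeasurableSet.iUnion fun i => (hclosed _ (hF i)).measurableSet
  refine measurable_generateFrom fun O hO => ?_
  obtain ⟨O', hO', rfl⟩ :=
    ConvexBody.isometry_toNonemptyCompacts.isUniformInducing.isInducing.isOpen_iff.1 hO
  obtain ⟨S, hS, rfl⟩ := NonemptyCompacts.isTopologicalBasis.open_eq_sUnion hO'
  obtain ⟨S', hS', hcount, hSS⟩ := isOpen_sUnion_countable S fun s hs =>
    NonemptyCompacts.isTopologicalBasis.isOpen (hS hs)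
  rw [← hSS, Set.sUnion_eq_biUnion, Set.preimage_iUnion₂, Set.preimage_iUnion₂]
  refine MeasurableSet.biUnion hS' fun s hs => ?_
  obtain ⟨u, ⟨hu, -, huo⟩, rfl⟩ := hS (hcount hs)
  have h1 : MeasurableSet {p | (T p : Set E) ⊆ ⋃₀ u} := by
    have := (hclosed (⋃₀ u)ᶜ (isOpen_sUnion huo).isClosed_compl).measurableSet.compl
    convert this using 1
    ext p
    simp [Set.not_nonempty_iff_eq_empty, ← Set.disjoint_iff_inter_eq_empty,
      Set.disjoint_compl_right_iff_subset]
  have h2 : MeasurableSet {p | ∀ U ∈ u, ((T p : Set E) ∩ U).Nonempty} := by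
    have : {p | ∀ U ∈ u, ((T p : Set E) ∩ U).Nonempty} =
        ⋂ U ∈ u, {p | ((T p : Set E) ∩ U).Nonempty} := by ext; simp
    rw [this]
    exact MeasurableSet.biInter hu.countable fun U hU => hopen U (huo U hU)
  exact h1.inter h2

end ConvexBodies

section UnitaryAction

variable {n : ℕ}

lemma actU_mul (g h : Matrix.unitaryGroup (Fin n) ℂ) (x : Cn n) :
    actU (g * h) x = actU g (actU h x) := by
  simp [actU, Matrix.toLpLin_apply]

@[simp] lemma actU_one (x : Cn n) : actU (1 : Matrix.unitaryGroup (Fin n) ℂ) x = x := by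
  simp [actU]

@[simp] lemma actU_inv_actU (g : Matrix.unitaryGroup (Fin n) ℂ) (x : Cn n) :
    actU g⁻¹ (actU g x) = x := by
  rw [← actU_mul, inv_mul_cancel, actU_one]

@[simp] lemma actU_actU_inv (g : Matrix.unitaryGroup (Fin n) ℂ) (x : Cn n) :
    actU g (actU g⁻¹ x) = x := by
  rw [← actU_mul, mul_inv_cancel, actU_one]

lemma inner_actU_actU (g : Matrix.unitaryGroup (Fin n) ℂ) (x y : Cn n) :
    inner ℂ (actU g x) (actU g y) = inner ℂ x y := by
  have hg : star (g : Matrix (Fin n) (Fin n) ℂ) * g = 1 := Matrix.mem_unitaryGroup_iff'.1 g.2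
  simp only [EuclideanSpace.inner_eq_star_dotProduct, actU, Matrix.toLpLin_apply,
    Matrix.star_mulVec]
  rw [dotProduct_comm, ← Matrix.dotProduct_mulVec, Matrix.mulVec_mulVec,
    ← Matrix.star_eq_conjTranspose, hg, Matrix.one_mulVec, dotProduct_comm]

/-- The action of a unitary matrix on `ℂⁿ`, as a linear isometric equivalence. -/
def actIso (g : Matrix.unitaryGroup (Fin n) ℂ) : Cn n ≃ₗᵢ[ℂ] Cn n :=
  LinearEquiv.isometryOfInner
    (LinearEquiv.ofLinearMap (Matrix.toEuclideanLin (g : Matrix (Fin n) (Fin n) ℂ))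
      (Matrix.toEuclideanLin ((g⁻¹ : Matrix.unitaryGroup (Fin n) ℂ) : Matrix (Fin n) (Fin n) ℂ))
      (LinearMap.ext (actU_actU_inv g)) (LinearMap.ext (actU_inv_actU g)))
    (inner_actU_actU g)

@[simp] lemma norm_actU (g : Matrix.unitaryGroup (Fin n) ℂ) (x : Cn n) : ‖actU g x‖ = ‖x‖ :=
  (actIso g).norm_map x

lemma actU_add (g : Matrix.unitaryGroup (Fin n) ℂ) (x y : Cn n) :
    actU g (x + y) = actU g x + actU g y := (actIso g).map_add x y

lemma actU_sub (g : Matrix.unitaryGroup (Fin n) ℂ) (x y : Cn n) :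
    actU g (x - y) = actU g x - actU g y := (actIso g).map_sub x y

lemma continuous_actU_uncurry :
    Continuous fun p : Matrix.unitaryGroup (Fin n) ℂ × Cn n => actU p.1 p.2 := by
  simp only [actU, Matrix.toLpLin_apply]
  refine (PiLp.continuous_toLp 2 _).comp ?_
  exact (continuous_subtype_val.comp continuous_fst).matrix_mulVec
    ((PiLp.continuous_ofLp 2 _).comp continuous_snd)

lemma continuous_actU_comp {X : Type*} [TopologicalSpace X]
    {g : X → Matrix.unitaryGroup (Fin n) ℂ} {f : X → Cn n} (hg : Continuous g)
    (hf : Continuous f) : Continuous fun p => actU (g p) (f p) := by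
  have h : Continuous fun p => (g p, f p) := hg.prodMk hf
  have h1 := continuous_actU_uncurry (n := n)
  have h2 := Continuous.comp h1 h
  simpa only [Function.comp_def] using h2

lemma image_actU (g : Matrix.unitaryGroup (Fin n) ℂ) (S : Set (Cn n)) :
    actU g '' S = actU g⁻¹ ⁻¹' S :=
  congrFun (Set.image_eq_preimage_of_inverse (actU_inv_actU g) (actU_actU_inv g)) S

lemma isCompact_preimage_actU (g : Matrix.unitaryGroup (Fin n) ℂ) {S : Set (Cn n)}
    (hS : IsCompact S) : IsCompact (actU g ⁻¹' S) :=
  (actIso g).toHomeomorph.isCompact_preimage.2 hS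

lemma convex_preimage_actU (g : Matrix.unitaryGroup (Fin n) ℂ) {S : Set (Cn n)}
    (hS : Convex ℝ S) : Convex ℝ (actU g ⁻¹' S) :=
  hS.is_linear_preimage ((actIso g).toLinearEquiv.toLinearMap.restrictScalars ℝ).isLinear

end UnitaryAction

section ExtendVal

variable {n : ℕ} {μ : ConvexBody (Cn n) → ℂ} {S : Set (Cn n)}

@[simp] lemma extendVal_coe (μ : ConvexBody (Cn n) → ℂ) (K : ConvexBody (Cn n)) :
    extendVal μ (K : Set (Cn n)) = μ K :=
  dif_pos ⟨K.convex, K.isCompact, K.nonempty⟩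

@[simp] lemma extendVal_empty (μ : ConvexBody (Cn n) → ℂ) : extendVal μ ∅ = 0 :=
  dif_neg fun h => Set.not_nonempty_empty h.2.2

lemma extendVal_image_eq_mul {f : Cn n → Cn n} {c : ℂ} (hc : Convex ℝ S) (hk : IsCompact S)
    (hfc : Convex ℝ (f '' S)) (hf : Continuous f)
    (h : ∀ K L : ConvexBody (Cn n), (L : Set (Cn n)) = f '' K → μ L = c * μ K) :
    extendVal μ (f '' S) = c * extendVal μ S := by
  rcases S.eq_empty_or_nonempty with rfl | hne
  · simp
  · obtain ⟨K, rfl⟩ : ∃ K : ConvexBody (Cn n), (K : Set (Cn n)) = S := ⟨⟨S, hc, hk, hne⟩, rfl⟩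
    obtain ⟨L, hL⟩ : ∃ L : ConvexBody (Cn n), (L : Set (Cn n)) = f '' K :=
      ⟨⟨_, hfc, hk.image hf, hne.image f⟩, rfl⟩
    rw [← hL, extendVal_coe, extendVal_coe, h K L hL]

lemma TranslationInvariant.extendVal_preimage_add (h3 : TranslationInvariant μ)
    (hc : Convex ℝ S) (hk : IsCompact S) (x : Cn n) :
    extendVal μ ((fun y => y + x) ⁻¹' S) = extendVal μ S := by
  have key := extendVal_image_eq_mul (μ := μ) (f := fun y => -x + y) (c := 1) hc hk
    (hc.translate (-x)) (by fun_prop) (fun K L hKL => by rw [one_mul]; exact h3 (-x) K L hKL)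
  rw [one_mul] at key
  rw [← key]
  congr 1
  rw [Set.image_add_left]
  simp [add_comm]

lemma UInvariant.extendVal_preimage_actU (h4 : UInvariant μ)
    (hc : Convex ℝ S) (hk : IsCompact S) (g : Matrix.unitaryGroup (Fin n) ℂ) :
    extendVal μ (actU g ⁻¹' S) = extendVal μ S := by
  have himage : actU g⁻¹ '' S = actU g ⁻¹' S := by rw [image_actU, inv_inv]
  have key := extendVal_image_eq_mul (μ := μ) (f := actU g⁻¹) (c := 1) hc hk
    (himage ▸ convex_preimage_actU g hc) (actIso g⁻¹).continuous
    (fun K L hKL => by rw [one_mul]; exact h4 _ (g⁻¹).2 K L hKL)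
  rw [← himage, key, one_mul]

lemma Homogeneous.extendVal_image_smul {k : ℕ} (h5 : Homogeneous k μ)
    (hc : Convex ℝ S) (hk : IsCompact S) {t : ℝ} (ht : 0 < t) :
    extendVal μ ((fun y => t • y) '' S) = (t : ℂ) ^ k * extendVal μ S :=
  extendVal_image_eq_mul hc hk (hc.smul t) (by fun_prop) (h5 t ht)

lemma IsValuation.extendVal_cut (h1 : IsValuation μ) (hc : Convex ℝ S) (hk : IsCompact S)
    {c : Cn n → ℝ} (hlin : IsLinearMap ℝ c) (hcont : Continuous c) (a : ℝ) :
    extendVal μ (S ∩ {z | c z ≤ a}) + extendVal μ (S ∩ {z | a ≤ c z}) =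
      extendVal μ S + extendVal μ (S ∩ {z | c z = a}) := by
  have hSle : Convex ℝ (S ∩ {z | c z ≤ a}) := hc.inter (convex_halfSpace_le hlin a)
  have hSge : Convex ℝ (S ∩ {z | a ≤ c z}) := hc.inter (convex_halfSpace_ge hlin a)
  have hSeq : Convex ℝ (S ∩ {z | c z = a}) := hc.inter (convex_hyperplane hlin a)
  have hkle := hk.inter_right (isClosed_le hcont (continuous_const (y := a)))
  have hkge := hk.inter_right (isClosed_le (continuous_const (y := a)) hcont)
  have hkeq := hk.inter_right (isClosed_eq hcont (continuous_const (y := a)))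
  rcases (S ∩ {z | c z ≤ a}).eq_empty_or_nonempty with hle | hle
  · have h2 : S ∩ {z | c z = a} = ∅ :=
      Set.subset_empty_iff.1 (hle ▸ Set.inter_subset_inter_right S fun z hz => le_of_eq hz)
    have h3 : S ∩ {z | a ≤ c z} = S := Set.inter_eq_left.2 fun z hz => by
      by_contra hza
      exact Set.notMem_empty z (hle ▸ ⟨hz, (le_of_not_ge hza : c z ≤ a)⟩)
    rw [hle, h2, h3, add_comm]
  rcases (S ∩ {z | a ≤ c z}).eq_empty_or_nonempty with hge | hge
  · have h2 : S ∩ {z | c z = a} = ∅ :=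
      Set.subset_empty_iff.1 (hge ▸ Set.inter_subset_inter_right S fun z hz => ge_of_eq hz)
    have h3 : S ∩ {z | c z ≤ a} = S := Set.inter_eq_left.2 fun z hz => by
      by_contra hza
      exact Set.notMem_empty z (hge ▸ ⟨hz, (le_of_not_ge hza : a ≤ c z)⟩)
    rw [hge, h2, h3]
  have heq : (S ∩ {z | c z = a}).Nonempty := by
    obtain ⟨x, hx, hxa⟩ := hle
    obtain ⟨y, hy, hya⟩ := hge
    obtain ⟨z, hz, hza⟩ := hc.isPreconnected.intermediate_value hx hy hcont.continuousOn ⟨hxa, hya⟩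
    exact ⟨z, hz, hza⟩
  have hne : S.Nonempty := heq.left
  have key := h1 ⟨_, hSle, hkle, hle⟩ ⟨_, hSge, hkge, hge⟩ ⟨_, hc, hk, hne⟩ ⟨_, hSeq, hkeq, heq⟩
    (by
      ext z
      simp only [ConvexBody.coe_mk, Set.mem_union, Set.mem_inter_iff, Set.mem_ofPred_eq]
      have := le_total (c z) a
      tauto)
    (by
      ext z
      simp only [ConvexBody.coe_mk, Set.mem_inter_iff, Set.mem_ofPred_eq]
      have := le_antisymm_iff (a := c z) (b := a)
      tauto)
  simpa only [← extendVal_coe μ, ConvexBody.coe_mk] using key.symm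

lemma exists_norm_extendVal_le (h2 : Continuous μ) (R : ℝ) :
    ∃ M : ℝ, 0 ≤ M ∧ ∀ S : Set (Cn n), S ⊆ Metric.closedBall 0 R → ‖extendVal μ S‖ ≤ M := by
  obtain ⟨M, hM⟩ := (ConvexBody.isCompact_subsets_of_isCompact
    (isCompact_closedBall (0 : Cn n) R)).exists_bound_of_continuousOn h2.continuousOn
  refine ⟨max M 0, le_max_right _ _, fun S hS => ?_⟩
  rw [extendVal]
  split_ifs with h
  · exact (hM _ hS).trans (le_max_left _ _)
  · simp

lemma Homogeneous.exists_norm_extendVal_le {k : ℕ} (h5 : Homogeneous k μ) (h2 : Continuous μ)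
    (R : ℝ) : ∃ M : ℝ, 0 ≤ M ∧ ∀ ε : ℝ, 0 < ε → ∀ S : Set (Cn n), Convex ℝ S → IsCompact S →
      S ⊆ Metric.closedBall 0 (ε * R) → ‖extendVal μ S‖ ≤ M * ε ^ k := by
  obtain ⟨M, hM0, hM⟩ := _root_.exists_norm_extendVal_le h2 R
  refine ⟨M, hM0, fun ε hε S hc hk hS => ?_⟩
  have hscale : (fun y : Cn n => ε • y) '' ((fun y : Cn n => ε⁻¹ • y) '' S) = S := by
    rw [Set.image_image]
    simp [smul_smul, hε.ne']
  rw [← hscale, h5.extendVal_image_smul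
    (show Convex ℝ ((fun y : Cn n => ε⁻¹ • y) '' S) from hc.smul ε⁻¹)
      (hk.image (by fun_prop)) hε, norm_mul,
    norm_pow, Complex.norm_real, Real.norm_of_nonneg hε.le, mul_comm]
  gcongr
  refine hM _ ?_
  rintro _ ⟨y, hy, rfl⟩
  have := hS hy
  rw [mem_closedBall_zero_iff] at this ⊢
  rw [norm_smul, norm_inv, Real.norm_of_nonneg hε.le, inv_mul_le_iff₀ hε]
  exact this

lemma tendsto_extendVal_of_antitone (h2 : Continuous μ) {T : ℕ → Set (Cn n)}
    (hT : Antitone T) (hc : ∀ i, Convex ℝ (T i)) (hk : ∀ i, IsCompact (T i)) :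
    Tendsto (fun i => extendVal μ (T i)) atTop (𝓝 (extendVal μ (⋂ i, T i))) := by
  by_cases hne : ∀ i, (T i).Nonempty
  · have hI : (⋂ i, T i).Nonempty :=
      IsCompact.nonempty_iInter_of_directed_nonempty_isCompact_isClosed T hT.directed_ge hne hk
        fun i => (hk i).isClosed
    have := (h2.tendsto _).comp (ConvexBody.tendsto_of_antitone
      (K := fun i => ⟨T i, hc i, hk i, hne i⟩)
      (L := ⟨⋂ i, T i, convex_iInter hc, (hk 0).of_isClosed_subset
        (isClosed_iInter fun i => (hk i).isClosed) (Set.iInter_subset _ 0), hI⟩) hT rfl)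
    simpa only [Function.comp_def, ← extendVal_coe μ, ConvexBody.coe_mk] using this
  · push Not at hne
    obtain ⟨i, hi⟩ := hne
    have h0 (j : ℕ) (hj : i ≤ j) : T j = ∅ := Set.subset_empty_iff.1 (hi ▸ hT hj)
    have hI : ⋂ i, T i = ∅ := Set.subset_empty_iff.1 (hi ▸ Set.iInter_subset T i)
    rw [hI, extendVal_empty]
    refine tendsto_const_nhds.congr' ?_
    filter_upwards [eventually_ge_atTop i] with j hj
    rw [h0 j hj, extendVal_empty]

lemma measurable_extendVal_of_isClosed_graph (h2 : Continuous μ)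
    {X : Type*} [TopologicalSpace X] [MeasurableSpace X] [OpensMeasurableSpace X]
    {C : Set (Cn n)} (hC : IsCompact C) (T : X → Set (Cn n)) (hT : ∀ p, T p ⊆ C)
    (hc : ∀ p, Convex ℝ (T p)) (hgraph : IsClosed {p : X × Cn n | p.2 ∈ T p.1}) :
    Measurable fun p => extendVal μ (T p) := by
  have hk (p : X) : IsCompact (T p) := by
    refine hC.of_isClosed_subset ?_ (hT p)
    exact hgraph.preimage (f := fun z => (p, z)) (by fun_prop)
  have : CompactSpace C := isCompact_iff_compactSpace.1 hC
  have hD : IsClosed {p | (T p).Nonempty} := by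
    have h1 := hgraph.preimage (f := fun p : X × C => (p.1, (p.2 : Cn n))) (by fun_prop)
    convert isClosedMap_fst_of_compactSpace _ h1 using 1
    ext p
    constructor
    · rintro ⟨x, hx⟩
      exact ⟨(p, ⟨x, hT p hx⟩), hx, rfl⟩
    · rintro ⟨⟨q, x⟩, hx, rfl⟩
      exact ⟨x, hx⟩
  refine measurable_of_restrict_of_restrict_compl hD.measurableSet ?_ ?_
  · let B : {p | (T p).Nonempty} → ConvexBody (Cn n) := fun p => ⟨T p, hc p, hk p, p.2⟩
    have hB := measurable_convexBody_of_isClosed_graph hC B (fun p => hT p)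
      (hgraph.preimage (f := fun p : {p | (T p).Nonempty} × Cn n => ((p.1 : X), p.2))
        (by fun_prop))
    let _ : MeasurableSpace (ConvexBody (Cn n)) := borel _
    have : BorelSpace (ConvexBody (Cn n)) := ⟨rfl⟩
    convert h2.measurable.comp hB using 1
    ext p
    exact extendVal_coe μ (B p)
  · have : ({p | (T p).Nonempty}ᶜ).domRestrict (fun p => extendVal μ (T p)) = fun _ => 0 := by
      ext p
      have hp : T p = ∅ := Set.not_nonempty_iff_eq_empty.1 p.2
      rw [Set.domRestrict_apply, hp, extendVal_empty]
    rw [this]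
    exact measurable_const

end ExtendVal

section Groups

variable {n : ℕ}

instance : BorelSpace (Matrix.unitaryGroup (Fin n) ℂ) := ⟨rfl⟩
instance : BorelSpace (SUgrp n) := ⟨rfl⟩

instance : SecondCountableTopology (Matrix (Fin n) (Fin n) ℂ) :=
  inferInstanceAs (SecondCountableTopology (Fin n → Fin n → ℂ))

instance : CompactSpace (Matrix.unitaryGroup (Fin n) ℂ) := by
  refine isCompact_iff_compactSpace.1 (?_ : IsCompact
    (Matrix.unitaryGroup (Fin n) ℂ : Set (Matrix (Fin n) (Fin n) ℂ)))
  have hbox : IsCompact (Set.univ.pi fun _ : Fin n => Set.univ.pi fun _ : Fin n =>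
      Metric.closedBall (0 : ℂ) 1) :=
    isCompact_univ_pi fun _ => isCompact_univ_pi fun _ => isCompact_closedBall _ _
  refine IsCompact.of_isClosed_subset (X := Matrix (Fin n) (Fin n) ℂ) hbox ?_ ?_
  · exact isClosed_unitary
  · intro g hg i _ j _
    exact mem_closedBall_zero_iff.2 (entry_norm_bound_of_unitary hg i j)

instance : SecondCountableTopology (Matrix.unitaryGroup (Fin n) ℂ) :=
  IsInducing.subtypeVal.secondCountableTopology

lemma isClosed_SUgrp : IsClosed (SUgrp n : Set (Matrix.unitaryGroup (Fin n) ℂ)) :=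
  isClosed_eq (f := fun g : Matrix.unitaryGroup (Fin n) ℂ =>
    Matrix.det (g : Matrix (Fin n) (Fin n) ℂ)) continuous_subtype_val.matrix_det continuous_const

instance : CompactSpace (SUgrp n) :=
  isCompact_iff_compactSpace.1 isClosed_SUgrp.isCompact

instance : SecondCountableTopology (SUgrp n) :=
  IsInducing.subtypeVal.secondCountableTopology

instance : (SUgrp n).Normal where
  conj_mem s hs g := by
    have hs' : Matrix.det (s : Matrix (Fin n) (Fin n) ℂ) = 1 := hs
    change Matrix.det ((g * s * g⁻¹ : Matrix.unitaryGroup (Fin n) ℂ) :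
      Matrix (Fin n) (Fin n) ℂ) = 1
    have hg : Matrix.det ((g * g⁻¹ : Matrix.unitaryGroup (Fin n) ℂ) :
      Matrix (Fin n) (Fin n) ℂ) = 1 := by simp
    rw [Matrix.UnitaryGroup.mul_val, Matrix.det_mul] at hg
    rw [Matrix.UnitaryGroup.mul_val, Matrix.UnitaryGroup.mul_val, Matrix.det_mul, Matrix.det_mul,
      hs', mul_one, hg]

/-- The automorphism of `SU(n)` given by conjugation with a unitary matrix. -/
def conjSU (g : Matrix.unitaryGroup (Fin n) ℂ) : SUgrp n ≃* SUgrp n := MulAut.conjNormal g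

lemma coe_conjSU (g : Matrix.unitaryGroup (Fin n) ℂ) (s : SUgrp n) :
    (conjSU g s : Matrix.unitaryGroup (Fin n) ℂ) = g * s * g⁻¹ := MulAut.conjNormal_apply g s

lemma continuous_conjSU (g : Matrix.unitaryGroup (Fin n) ℂ) : Continuous (conjSU g) := by
  have h : Continuous fun s : SUgrp n => (conjSU g s : Matrix.unitaryGroup (Fin n) ℂ) := by
    simp only [coe_conjSU]
    fun_prop
  exact continuous_induced_rng.2 h

lemma integral_SUgrp_mul_mul (ν : Measure (SUgrp n)) [ν.IsHaarMeasure] [IsProbabilityMeasure ν]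
    {a b : Matrix.unitaryGroup (Fin n) ℂ} (hab : a * b ∈ SUgrp n)
    (f : Matrix.unitaryGroup (Fin n) ℂ → ℂ) :
    ∫ s, f (a * s * b) ∂ν = ∫ s, f s ∂ν := by
  have hsymm : Continuous (conjSU a).symm := by
    have : ⇑(conjSU a).symm = conjSU a⁻¹ := by
      ext s : 1
      rw [MulEquiv.symm_apply_eq]
      apply Subtype.ext
      rw [coe_conjSU, coe_conjSU]
      group
    rw [this]
    exact continuous_conjSU a⁻¹
  have h1 : (ν.map (conjSU a)).IsHaarMeasure :=
    MulEquiv.isHaarMeasure_map ν (conjSU a) (continuous_conjSU a) hsymm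
  have h1P : IsProbabilityMeasure (ν.map (conjSU a)) :=
    Measure.isProbabilityMeasure_map (continuous_conjSU a).aemeasurable
  have h2 : ν.map (conjSU a) = ν := Measure.isHaarMeasure_eq_of_isProbabilityMeasure _ _
  let e : SUgrp n ≃ₜ SUgrp n := ⟨(conjSU a).toEquiv, continuous_conjSU a, hsymm⟩
  have h3 : MeasurePreserving e ν ν := ⟨e.continuous.measurable, h2⟩
  let d : SUgrp n := ⟨a * b, hab⟩
  have h4 : (ν.map (· * d)).IsHaarMeasure := inferInstance
  have h4P : IsProbabilityMeasure (ν.map (· * d)) :=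
    Measure.isProbabilityMeasure_map (continuous_mul_const d).aemeasurable
  have h5 : MeasurePreserving (· * d) ν ν :=
    ⟨(continuous_mul_const d).measurable, Measure.isHaarMeasure_eq_of_isProbabilityMeasure _ _⟩
  have e5 := h5.integral_comp (Homeomorph.mulRight d).measurableEmbedding
    (fun s : SUgrp n => f (s : Matrix.unitaryGroup (Fin n) ℂ))
  have e3 := h3.integral_comp e.measurableEmbedding
    (fun s : SUgrp n => f ((s * d : SUgrp n) : Matrix.unitaryGroup (Fin n) ℂ))
  rw [← e5, ← e3]
  refine integral_congr_ae (ae_of_all _ fun s => ?_)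
  have hs : (e s * d : SUgrp n) = a * (s : Matrix.unitaryGroup (Fin n) ℂ) * b := by
    change (conjSU a s : Matrix.unitaryGroup (Fin n) ℂ) * (a * b) = _
    rw [coe_conjSU]
    group
  simp only [hs]

end Groups

section Integrability

variable {n : ℕ} {μ : ConvexBody (Cn n) → ℂ}

lemma integrable_extendVal_of_isClosed_graph (h2 : Continuous μ)
    {X : Type*} [TopologicalSpace X] [MeasurableSpace X] [OpensMeasurableSpace X]
    {ν : Measure X} {C : Set (Cn n)} (hC : IsCompact C) (T : X → Set (Cn n)) (hT : ∀ p, T p ⊆ C)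
    (hc : ∀ p, Convex ℝ (T p)) (hgraph : IsClosed {p : X × Cn n | p.2 ∈ T p.1})
    {B : Set X} (hB : ν B ≠ ∞) (hsupp : ∀ p z, z ∈ T p → p ∈ B) :
    Integrable (fun p => extendVal μ (T p)) ν := by
  obtain ⟨R, hR⟩ := hC.isBounded.subset_closedBall 0
  obtain ⟨M, -, hM⟩ := exists_norm_extendVal_le h2 R
  have hmeas := measurable_extendVal_of_isClosed_graph h2 hC T hT hc hgraph
  have hon : IntegrableOn (fun p => extendVal μ (T p)) B ν :=
    Measure.integrableOn_of_bounded hB hmeas.aestronglyMeasurable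
      (ae_of_all _ fun p => hM _ ((hT p).trans hR))
  refine hon.integrable_of_forall_notMem_eq_zero fun p hp => ?_
  have : T p = ∅ := Set.eq_empty_of_forall_notMem fun z hz => hp (hsupp p z hz)
  rw [this, extendVal_empty]

end Integrability

section Window

variable {n : ℕ} {μ : ConvexBody (Cn n) → ℂ} {S : Set (Cn n)} {d : ℕ}

/-- The points `z` with `tᵢ ≤ cᵢ z ≤ tᵢ + ε` for all `i`; the indices with `b i` impose the
degenerate condition `cᵢ z = tᵢ`. -/
def slab (c : Fin d → Cn n →L[ℝ] ℝ) (ε : ℝ) (b : Fin d → Bool) (t : Fin d → ℝ) : Set (Cn n) :=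
  {z | ∀ i, t i ≤ c i z ∧ c i z ≤ t i + if b i then 0 else ε}

/-- The sign `(-1)^{#b}`. -/
def boolSign (b : Fin d → Bool) : ℂ := ∏ i, if b i then -1 else 1

lemma norm_boolSign (b : Fin d → Bool) : ‖boolSign b‖ = 1 := by
  rw [boolSign, norm_prod]
  refine Finset.prod_eq_one fun i _ => ?_
  split_ifs <;> simp

lemma mem_slab {c : Fin d → Cn n →L[ℝ] ℝ} {ε : ℝ} {b : Fin d → Bool} {t : Fin d → ℝ} {z : Cn n} :
    z ∈ slab c ε b t ↔ ∀ i, t i ≤ c i z ∧ c i z ≤ t i + if b i then 0 else ε := Iff.rfl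

lemma convex_slab (c : Fin d → Cn n →L[ℝ] ℝ) (ε : ℝ) (b : Fin d → Bool) (t : Fin d → ℝ) :
    Convex ℝ (slab c ε b t) := by
  have : slab c ε b t = ⋂ i, ({z | t i ≤ c i z} ∩ {z | c i z ≤ t i + if b i then 0 else ε}) := by
    ext z
    simp [slab]
  rw [this]
  exact convex_iInter fun i => (convex_halfSpace_ge (c i).isLinear _).inter
    (convex_halfSpace_le (c i).isLinear _)

lemma isClosed_slab_graph (c : Fin d → Cn n →L[ℝ] ℝ) (ε : ℝ) (b : Fin d → Bool) :
    IsClosed {p : (Fin d → ℝ) × Cn n | p.2 ∈ slab c ε b p.1} := by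
  simp only [mem_slab, Set.ofPred_forall, Set.ofPred_and]
  refine isClosed_iInter fun i => (isClosed_le ?_ ?_).inter (isClosed_le ?_ ?_) <;> fun_prop

lemma isClosed_slab (c : Fin d → Cn n →L[ℝ] ℝ) (ε : ℝ) (b : Fin d → Bool) (t : Fin d → ℝ) :
    IsClosed (slab c ε b t) :=
  (isClosed_slab_graph c ε b).preimage (f := fun z => (t, z)) (by fun_prop)

lemma slab_cons (c : Fin (d + 1) → Cn n →L[ℝ] ℝ) (ε : ℝ) (b₀ : Bool) (b : Fin d → Bool)
    (t₀ : ℝ) (t : Fin d → ℝ) :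
    slab c ε (Fin.cons b₀ b) (Fin.cons t₀ t) =
      {z | t₀ ≤ c 0 z ∧ c 0 z ≤ t₀ + if b₀ then 0 else ε} ∩ slab (fun i => c i.succ) ε b t := by
  ext z
  simp only [mem_slab, Fin.forall_fin_succ, Fin.cons_zero, Fin.cons_succ, Set.mem_inter_iff,
    Set.mem_ofPred_eq]

lemma boolSign_cons (b₀ : Bool) (b : Fin d → Bool) :
    boolSign (Fin.cons b₀ b : Fin (d + 1) → Bool) = (if b₀ then -1 else 1) * boolSign b := by
  simp [boolSign, Fin.prod_univ_succ]

lemma sum_bool_fin_succ (f : (Fin (d + 1) → Bool) → ℂ) :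
    ∑ b, f b = ∑ b₀, ∑ b, f (Fin.cons b₀ b) := by
  rw [← Fintype.sum_prod_type' (fun b₀ b => f (Fin.cons b₀ b))]
  exact (Fintype.sum_equiv (Fin.consEquiv fun _ => Bool) _ _ fun _ => rfl).symm

lemma integrable_extendVal_slab (h2 : Continuous μ) (c : Fin d → Cn n →L[ℝ] ℝ) {ε : ℝ}
    (hε : 0 < ε) (hc : Convex ℝ S) (hk : IsCompact S) (b : Fin d → Bool) :
    Integrable fun t => extendVal μ (S ∩ slab c ε b t) := by
  have hbd : ∃ r : ℝ, 0 ≤ r ∧ ∀ z ∈ S, ∀ i, |c i z| ≤ r := by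
    obtain ⟨r, hr⟩ := hk.exists_bound_of_continuousOn
      (f := fun z i => c i z) (by fun_prop)
    exact ⟨max r 0, le_max_right _ _, fun z hz i =>
      (norm_le_pi_norm (fun i => c i z) i).trans ((hr z hz).trans (le_max_left _ _))⟩
  obtain ⟨r, hr0, hr⟩ := hbd
  refine integrable_extendVal_of_isClosed_graph h2 hk _ (fun _ => Set.inter_subset_left)
    (fun t => hc.inter (convex_slab c ε b t))
    ((hk.isClosed.preimage continuous_snd).inter (isClosed_slab_graph c ε b))
    (B := Metric.closedBall 0 (r + ε)) (isCompact_closedBall _ _).measure_lt_top.ne ?_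
  rintro t z ⟨hz, ht⟩
  rw [mem_closedBall_zero_iff, pi_norm_le_iff_of_nonneg (by positivity)]
  intro i
  have h1 := abs_le.1 (hr z hz i)
  obtain ⟨h3, h4⟩ := ht i
  rw [Real.norm_eq_abs, abs_le]
  split_ifs at h4 <;> constructor <;> linarith

lemma integral_extendVal_slab_one (h1 : IsValuation μ) (h2 : Continuous μ) (c : Cn n →L[ℝ] ℝ)
    {ε : ℝ} (hε : 0 < ε) (hc : Convex ℝ S) (hk : IsCompact S) :
    ∫ t : ℝ, ∑ b : Bool, (if b then -1 else 1) *
      extendVal μ (S ∩ {z | t ≤ c z ∧ c z ≤ t + if b then 0 else ε}) = ε * extendVal μ S := by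
  set G : ℝ → ℂ := fun t => extendVal μ (S ∩ {z | c z ≤ t}) with hG
  have hstep (t : ℝ) : (∑ b : Bool, (if b then -1 else 1) *
      extendVal μ (S ∩ {z | t ≤ c z ∧ c z ≤ t + if b then 0 else ε})) = G (t + ε) - G t := by
    have key := h1.extendVal_cut (hc.inter (convex_halfSpace_le c.isLinear (t + ε)))
      (hk.inter_right (isClosed_le c.continuous continuous_const)) c.isLinear c.continuous t
    have e1 : S ∩ {z | c z ≤ t + ε} ∩ {z | c z ≤ t} = S ∩ {z | c z ≤ t} := by
      ext z; simp only [Set.mem_inter_iff, Set.mem_ofPred_eq]; grind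
    have e2 : S ∩ {z | c z ≤ t + ε} ∩ {z | t ≤ c z} = S ∩ {z | t ≤ c z ∧ c z ≤ t + ε} := by
      ext z; simp only [Set.mem_inter_iff, Set.mem_ofPred_eq]; grind
    have e3 : S ∩ {z | c z ≤ t + ε} ∩ {z | c z = t} = S ∩ {z | t ≤ c z ∧ c z ≤ t + 0} := by
      ext z; simp only [Set.mem_inter_iff, Set.mem_ofPred_eq]; grind
    simp only [ContinuousLinearMap.coe_coe] at key
    rw [e1, e2, e3] at key
    simp only [Fintype.sum_bool, if_true, Bool.false_eq_true, if_false]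
    linear_combination key
  obtain ⟨r, hr⟩ := hk.exists_bound_of_continuousOn c.continuous.continuousOn
  obtain ⟨R, hR⟩ := hk.isBounded.subset_closedBall 0
  obtain ⟨M, -, hM⟩ := exists_norm_extendVal_le h2 R
  have hGmeas : Measurable G :=
    measurable_extendVal_of_isClosed_graph h2 hk _ (fun _ => Set.inter_subset_left)
      (fun t => hc.inter (convex_halfSpace_le c.isLinear t))
      ((hk.isClosed.preimage continuous_snd).inter (isClosed_le (by fun_prop) (by fun_prop)))
  set H : ℝ → ℂ := fun t => G t - (Set.Ici (0 : ℝ)).indicator (fun _ => extendVal μ S) t with hH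
  have hHmeas : Measurable H :=
    hGmeas.sub (measurable_const.indicator measurableSet_Ici)
  have hHint : Integrable H := by
    have hon : IntegrableOn H (Set.Icc (-|r|) |r|) := by
      refine Measure.integrableOn_of_bounded (M := M + M) measure_Icc_lt_top.ne
        hHmeas.aestronglyMeasurable (ae_of_all _ fun t => ?_)
      refine (norm_sub_le _ _).trans (add_le_add (hM _ (Set.inter_subset_left.trans hR)) ?_)
      exact (norm_indicator_le_norm_self _ _).trans (hM _ hR)
    refine hon.integrable_of_forall_notMem_eq_zero fun t ht => ?_
    have hr' (z : Cn n) (hz : z ∈ S) : -|r| ≤ c z ∧ c z ≤ |r| :=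
      abs_le.1 ((hr z hz).trans (le_abs_self r))
    rcases lt_or_ge t (-|r|) with h | h
    · have h0 : t ∉ Set.Ici (0 : ℝ) := fun h0 => by
        have := abs_nonneg r
        have : 0 ≤ t := h0
        linarith
      have he : S ∩ {z | c z ≤ t} = ∅ := by
        refine Set.eq_empty_of_forall_notMem fun z hz => ?_
        have h3 := (hr' z hz.1).1
        have h4 : c z ≤ t := hz.2
        linarith
      simp only [hH, hG, he, extendVal_empty, Set.indicator_of_notMem h0, sub_zero]
    · have h' : |r| < t := lt_of_not_ge fun h' => ht ⟨h, h'⟩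
      have h0 : t ∈ Set.Ici (0 : ℝ) := (abs_nonneg r).trans h'.le
      have he : S ∩ {z | c z ≤ t} = S :=
        Set.inter_eq_left.2 fun z hz => ((hr' z hz).2.trans h'.le : c z ≤ t)
      simp only [hH, hG, he, Set.indicator_of_mem h0, sub_self]
  have hGH (t : ℝ) : G (t + ε) - G t =
      (H (t + ε) - H t) + (Set.Ico (-ε) 0).indicator (fun _ => extendVal μ S) t := by
    simp only [hH, Set.indicator, Set.mem_Ici, Set.mem_Ico]
    split_ifs <;> first | (exfalso; grind) | ring
  simp only [hstep, hGH]
  have hHsub : Integrable fun t => H (t + ε) - H t := (hHint.comp_add_right ε).sub hHint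
  rw [integral_add hHsub ((integrable_indicator_iff measurableSet_Ico).2
      (integrableOn_const measure_Ico_lt_top.ne)),
    integral_sub (hHint.comp_add_right ε) hHint, integral_add_right_eq_self, sub_self, zero_add,
    integral_indicator measurableSet_Ico, setIntegral_const, measureReal_def, Real.volume_Ico]
  simp [hε.le]

lemma integral_extendVal_slab (h1 : IsValuation μ) (h2 : Continuous μ)
    (c : Fin d → Cn n →L[ℝ] ℝ) {ε : ℝ} (hε : 0 < ε) (hc : Convex ℝ S) (hk : IsCompact S) :
    ∫ t, ∑ b, boolSign b * extendVal μ (S ∩ slab c ε b t) = ε ^ d * extendVal μ S := by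
  induction d generalizing S with
  | zero => simp [Measure.volume_pi_eq_dirac (x := 0), boolSign, slab]
  | succ d ih =>
    have hmp := (volume_preserving_piFinSuccAbove (fun _ : Fin (d + 1) => ℝ) 0).symm
    have hcons (p : ℝ × (Fin d → ℝ)) :
        (MeasurableEquiv.piFinSuccAbove (fun _ : Fin (d + 1) => ℝ) 0).symm p =
          Fin.cons p.1 p.2 := by
      simp [MeasurableEquiv.piFinSuccAbove, Fin.consEquiv]
    rw [← hmp.integral_comp']
    have hint : Integrable fun t => ∑ b, boolSign b * extendVal μ (S ∩ slab c ε b t) :=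
      integrable_finsetSum _ fun b _ => (integrable_extendVal_slab h2 c hε hc hk b).const_mul _
    have hint' := hmp.integrable_comp_of_integrable hint
    simp only [Function.comp_def] at hint'
    rw [Measure.volume_eq_prod] at hint' ⊢
    rw [integral_prod _ hint']
    have hinner (t₀ : ℝ) : (∫ t : Fin d → ℝ, ∑ b, boolSign b * extendVal μ (S ∩ slab c ε b
        ((MeasurableEquiv.piFinSuccAbove (fun _ : Fin (d + 1) => ℝ) 0).symm (t₀, t)))) =
        ε ^ d * ∑ b : Bool, (if b then -1 else 1) *
          extendVal μ (S ∩ {z | t₀ ≤ c 0 z ∧ c 0 z ≤ t₀ + if b then 0 else ε}) := by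
      have hcS (b : Bool) :
          Convex ℝ (S ∩ {z | t₀ ≤ c 0 z ∧ c 0 z ≤ t₀ + if b then 0 else ε}) :=
        hc.inter ((convex_halfSpace_ge (c 0).isLinear _).inter
          (convex_halfSpace_le (c 0).isLinear _))
      have hkS (b : Bool) :
          IsCompact (S ∩ {z | t₀ ≤ c 0 z ∧ c 0 z ≤ t₀ + if b then 0 else ε}) :=
        hk.inter_right ((isClosed_le continuous_const (c 0).continuous).inter
          (isClosed_le (c 0).continuous continuous_const))
      simp only [hcons, sum_bool_fin_succ, slab_cons, boolSign_cons, ← Set.inter_assoc, mul_assoc,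
        ← Finset.mul_sum]
      rw [integral_finsetSum _ fun b _ => (integrable_finsetSum _ fun b' _ =>
        (integrable_extendVal_slab h2 _ hε (hcS b) (hkS b) b').const_mul _).const_mul _,
        Finset.mul_sum]
      refine Finset.sum_congr rfl fun b _ => ?_
      rw [integral_const_mul, ih _ (hcS b) (hkS b)]
      ring
    simp only [hinner]
    rw [integral_const_mul, integral_extendVal_slab_one h1 h2 (c 0) hε hc hk]
    ring

end Window

section UnitCube

variable {n : ℕ} {μ : ConvexBody (Cn n) → ℂ} {S : Set (Cn n)}

/-- The real orthonormal coordinates on `ℂⁿ`. -/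
def realCoord (n : ℕ) (i : Fin (Module.finrank ℝ (Cn n))) : Cn n →L[ℝ] ℝ :=
  innerSL ℝ (stdOrthonormalBasis ℝ (Cn n) i)

/-- The face of the cube with side `ε` on which the coordinates selected by `b` vanish. -/
def cubeFace (n : ℕ) (ε : ℝ) (b : Fin (Module.finrank ℝ (Cn n)) → Bool) : Set (Cn n) :=
  slab (realCoord n) ε b 0

lemma convex_cubeFace (ε : ℝ) (b : Fin (Module.finrank ℝ (Cn n)) → Bool) :
    Convex ℝ (cubeFace n ε b) := convex_slab _ _ _ _

lemma isClosed_cubeFace (ε : ℝ) (b : Fin (Module.finrank ℝ (Cn n)) → Bool) :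
    IsClosed (cubeFace n ε b) := isClosed_slab _ _ _ _

lemma cubeFace_subset {ε : ℝ} (hε : 0 ≤ ε) (b : Fin (Module.finrank ℝ (Cn n)) → Bool) :
    cubeFace n ε b ⊆ Metric.closedBall 0 (ε * Module.finrank ℝ (Cn n)) := by
  intro z hz
  have hz' (i : Fin (Module.finrank ℝ (Cn n))) : |realCoord n i z| ≤ ε := by
    obtain ⟨h3, h4⟩ := hz i
    simp only [Pi.zero_apply] at h3 h4
    rw [abs_le]
    split_ifs at h4 <;> constructor <;> linarith
  rw [mem_closedBall_zero_iff, ← (stdOrthonormalBasis ℝ (Cn n)).sum_repr' z]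
  refine (norm_sum_le _ _).trans ?_
  calc ∑ i, ‖inner ℝ (stdOrthonormalBasis ℝ (Cn n) i) z • stdOrthonormalBasis ℝ (Cn n) i‖
      ≤ ∑ _i : Fin (Module.finrank ℝ (Cn n)), ε := Finset.sum_le_sum fun i _ => by
        rw [norm_smul, (stdOrthonormalBasis ℝ (Cn n)).norm_eq_one, mul_one]
        exact hz' i
    _ = ε * Module.finrank ℝ (Cn n) := by simp [mul_comm]

lemma slab_realCoord (ε : ℝ) (b : Fin (Module.finrank ℝ (Cn n)) → Bool) (y : Cn n) :
    slab (realCoord n) ε b (fun i => realCoord n i y) = {z | z - y ∈ cubeFace n ε b} := by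
  ext z
  simp only [cubeFace, mem_slab, Set.mem_ofPred_eq, map_sub, Pi.zero_apply, sub_nonneg, zero_add,
    sub_le_iff_le_add']

lemma integral_extendVal_inter_cubeFace (h1 : IsValuation μ) (h2 : Continuous μ) {ε : ℝ}
    (hε : 0 < ε) (hc : Convex ℝ S) (hk : IsCompact S) :
    ∫ y : Cn n, ∑ b, boolSign b * extendVal μ (S ∩ {z | z - y ∈ cubeFace n ε b}) =
      ε ^ Module.finrank ℝ (Cn n) * extendVal μ S := by
  rw [← integral_extendVal_slab h1 h2 (realCoord n) hε hc hk]
  have hmp := (stdOrthonormalBasis ℝ (Cn n)).measurePreserving_measurableEquiv.trans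
    (EuclideanSpace.volume_preserving_symm_measurableEquiv_toLp _)
  rw [← hmp.integral_comp']
  simp only [← slab_realCoord]
  refine integral_congr_ae (ae_of_all _ fun y => ?_)
  have hy : ((stdOrthonormalBasis ℝ (Cn n)).measurableEquiv.trans
      (MeasurableEquiv.toLp 2 (Fin (Module.finrank ℝ (Cn n)) → ℝ)).symm) y =
      fun i => realCoord n i y := by
    ext i
    exact (stdOrthonormalBasis ℝ (Cn n)).repr_apply_apply y i
  simp only [hy]

lemma measurePreserving_actU (g : Matrix.unitaryGroup (Fin n) ℂ) :
    MeasurePreserving (actU g : Cn n → Cn n) volume volume :=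
  LinearIsometryEquiv.measurePreserving
    (⟨(actIso g).toLinearEquiv.restrictScalars ℝ, (actIso g).norm_map⟩ : Cn n ≃ₗᵢ[ℝ] Cn n)

lemma integral_comp_actU (g : Matrix.unitaryGroup (Fin n) ℂ) (f : Cn n → ℂ) :
    ∫ x, f (actU g x) = ∫ x, f x :=
  (measurePreserving_actU g).integral_comp
    (actIso g).toHomeomorph.measurableEmbedding f

lemma convex_preimage_add (hS : Convex ℝ S) (y : Cn n) : Convex ℝ {z | z + y ∈ S} :=
  hS.translate_preimage_left y

lemma convex_preimage_actU_sub (hS : Convex ℝ S) (g : Matrix.unitaryGroup (Fin n) ℂ) (x : Cn n) :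
    Convex ℝ {z | actU g (z - x) ∈ S} := by
  simp only [sub_eq_add_neg]
  exact convex_preimage_add (convex_preimage_actU g hS) (-x)

lemma integral_extendVal_inter_cubeFace_actU (h1 : IsValuation μ) (h2 : Continuous μ)
    (h4 : UInvariant μ) {ε : ℝ} (hε : 0 < ε) (hc : Convex ℝ S) (hk : IsCompact S)
    (h : Matrix.unitaryGroup (Fin n) ℂ) :
    ∫ y : Cn n, ∑ b, boolSign b *
      extendVal μ (S ∩ {z | actU h⁻¹ (z - y) ∈ cubeFace n ε b}) =
      ε ^ Module.finrank ℝ (Cn n) * extendVal μ S := by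
  rw [← integral_comp_actU h, ← h4.extendVal_preimage_actU hc hk h,
    ← integral_extendVal_inter_cubeFace h1 h2 hε (convex_preimage_actU h hc)
      (isCompact_preimage_actU h hk)]
  refine integral_congr_ae (ae_of_all _ fun y => Finset.sum_congr rfl fun b _ => ?_)
  have hC : IsClosed {z | actU h⁻¹ (z - actU h y) ∈ cubeFace n ε b} :=
    (isClosed_cubeFace ε b).preimage ((actIso h⁻¹).continuous.comp (by fun_prop))
  have hCc := convex_preimage_actU_sub (convex_cubeFace (n := n) ε b) h⁻¹ (actU h y)
  rw [← h4.extendVal_preimage_actU (hc.inter hCc) (hk.inter_right hC) h]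
  congr 2
  ext z
  simp [← actU_sub]

end UnitCube

section Localization

variable {n : ℕ} {μ : ConvexBody (Cn n) → ℂ} {K L : Set (Cn n)}

/-- The intersection of `K` with the image of `L` under `z ↦ g z + x`. -/
def kinInter (K L : Set (Cn n)) (g : Matrix.unitaryGroup (Fin n) ℂ) (x : Cn n) : Set (Cn n) :=
  K ∩ {z | actU g⁻¹ (z - x) ∈ L}

/-- The part of `(K - y) ∩ g (L - q)` lying in the face `h C_b` of a rotated cube. -/
def locInter (K L : Set (Cn n)) (ε : ℝ) (b : Fin (Module.finrank ℝ (Cn n)) → Bool)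
    (g h : Matrix.unitaryGroup (Fin n) ℂ) (y q : Cn n) : Set (Cn n) :=
  {z | z + y ∈ K} ∩ {z | actU g⁻¹ z + q ∈ L} ∩ {z | actU h⁻¹ z ∈ cubeFace n ε b}

/-- The alternating sum of `μ` over the faces of a rotated cube. -/
def locVal (μ : ConvexBody (Cn n) → ℂ) (K L : Set (Cn n)) (ε : ℝ)
    (g h : Matrix.unitaryGroup (Fin n) ℂ) (y q : Cn n) : ℂ :=
  ∑ b, boolSign b * extendVal μ (locInter K L ε b g h y q)

lemma mem_kinInter {g : Matrix.unitaryGroup (Fin n) ℂ} {x z : Cn n} :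
    z ∈ kinInter K L g x ↔ z ∈ K ∧ actU g⁻¹ (z - x) ∈ L := Iff.rfl

lemma mem_locInter {ε : ℝ} {b : Fin (Module.finrank ℝ (Cn n)) → Bool}
    {g h : Matrix.unitaryGroup (Fin n) ℂ} {y q z : Cn n} : z ∈ locInter K L ε b g h y q ↔
    (z + y ∈ K ∧ actU g⁻¹ z + q ∈ L) ∧ actU h⁻¹ z ∈ cubeFace n ε b := Iff.rfl

lemma convex_kinInter (hK : Convex ℝ K) (hL : Convex ℝ L) (g : Matrix.unitaryGroup (Fin n) ℂ)
    (x : Cn n) : Convex ℝ (kinInter K L g x) := by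
  exact hK.inter (convex_preimage_actU_sub hL g⁻¹ x)

lemma convex_locInter (hK : Convex ℝ K) (hL : Convex ℝ L) (ε : ℝ)
    (b : Fin (Module.finrank ℝ (Cn n)) → Bool) (g h : Matrix.unitaryGroup (Fin n) ℂ) (y q : Cn n) :
    Convex ℝ (locInter K L ε b g h y q) :=
  ((convex_preimage_add hK y).inter
    (convex_preimage_actU g⁻¹ (convex_preimage_add hL q))).inter
    (convex_preimage_actU h⁻¹ (convex_cubeFace ε b))

lemma isClosed_kinInter_graph (hK : IsClosed K) (hL : IsClosed L) :
    IsClosed {p : (Matrix.unitaryGroup (Fin n) ℂ × Cn n) × Cn n |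
      p.2 ∈ kinInter K L p.1.1 p.1.2} := by
  refine (hK.preimage continuous_snd).inter (hL.preimage ?_)
  exact continuous_actU_comp (continuous_inv.comp (continuous_fst.comp continuous_fst))
    (continuous_snd.sub (continuous_snd.comp continuous_fst))

lemma isClosed_locInter_graph (hK : IsClosed K) (hL : IsClosed L) (ε : ℝ)
    (b : Fin (Module.finrank ℝ (Cn n)) → Bool) :
    IsClosed {p : ((Matrix.unitaryGroup (Fin n) ℂ × Matrix.unitaryGroup (Fin n) ℂ) ×
      (Cn n × Cn n)) × Cn n | p.2 ∈ locInter K L ε b p.1.1.1 p.1.1.2 p.1.2.1 p.1.2.2} := by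
  refine ((hK.preimage ?_).inter (hL.preimage ?_)).inter ((isClosed_cubeFace ε b).preimage ?_)
  · fun_prop
  · exact (continuous_actU_comp (continuous_inv.comp (by fun_prop)) (by fun_prop)).add
      (by fun_prop)
  · exact continuous_actU_comp (continuous_inv.comp (by fun_prop)) (by fun_prop)

lemma isCompact_kinInter (hK : IsCompact K) (hL : IsClosed L)
    (g : Matrix.unitaryGroup (Fin n) ℂ) (x : Cn n) : IsCompact (kinInter K L g x) :=
  hK.of_isClosed_subset ((isClosed_kinInter_graph hK.isClosed hL).preimage
    (f := fun z => ((g, x), z)) (by fun_prop)) Set.inter_subset_left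

lemma locInter_subset {ε : ℝ} (hε : 0 ≤ ε) (b : Fin (Module.finrank ℝ (Cn n)) → Bool)
    (g h : Matrix.unitaryGroup (Fin n) ℂ) (y q : Cn n) :
    locInter K L ε b g h y q ⊆ Metric.closedBall 0 (ε * Module.finrank ℝ (Cn n)) := by
  intro z hz
  have := cubeFace_subset hε b hz.2
  rw [mem_closedBall_zero_iff] at this ⊢
  rwa [norm_actU] at this

lemma isCompact_locInter (hK : IsClosed K) (hL : IsClosed L) {ε : ℝ} (hε : 0 ≤ ε)
    (b : Fin (Module.finrank ℝ (Cn n)) → Bool)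
    (g h : Matrix.unitaryGroup (Fin n) ℂ) (y q : Cn n) : IsCompact (locInter K L ε b g h y q) :=
  (isCompact_closedBall _ _).of_isClosed_subset ((isClosed_locInter_graph hK hL ε b).preimage
    (f := fun z => (((g, h), (y, q)), z)) (by fun_prop)) (locInter_subset hε b g h y q)

end Localization

section LocalFormula

variable {n : ℕ} {μ : ConvexBody (Cn n) → ℂ} {K L : Set (Cn n)}

lemma integrable_locVal (h2 : Continuous μ) (hKc : Convex ℝ K) (hKk : IsCompact K)
    (hLc : Convex ℝ L) (hLk : IsCompact L) {RK RL : ℝ} (hRK : K ⊆ Metric.closedBall 0 RK)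
    (hRL : L ⊆ Metric.closedBall 0 RL) {ε : ℝ} (hε : 0 ≤ ε)
    {X : Type*} [TopologicalSpace X] [MeasurableSpace X] [OpensMeasurableSpace X] {ν : Measure X}
    {φ : X → (Matrix.unitaryGroup (Fin n) ℂ × Matrix.unitaryGroup (Fin n) ℂ) × (Cn n × Cn n)}
    (hφ : Continuous φ) {B : Set X} (hB : ν B ≠ ∞)
    (hsupp : ∀ p, ‖(φ p).2.1‖ ≤ RK + ε * Module.finrank ℝ (Cn n) →
      ‖(φ p).2.2‖ ≤ RL + ε * Module.finrank ℝ (Cn n) → p ∈ B) :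
    Integrable (fun p => locVal μ K L ε (φ p).1.1 (φ p).1.2 (φ p).2.1 (φ p).2.2) ν := by
  refine integrable_finsetSum _ fun b _ => Integrable.const_mul ?_ _
  refine integrable_extendVal_of_isClosed_graph h2
    (isCompact_closedBall (0 : Cn n) (ε * Module.finrank ℝ (Cn n))) _
    (fun p => locInter_subset hε b _ _ _ _) (fun p => convex_locInter hKc hLc ε b _ _ _ _)
    ((isClosed_locInter_graph hKk.isClosed hLk.isClosed ε b).preimage
      (f := fun p : X × Cn n => (φ p.1, p.2)) (by fun_prop)) hB ?_
  intro p z hz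
  have hz0 := locInter_subset hε b _ _ _ _ hz
  obtain ⟨⟨hzK, hzL⟩, -⟩ := hz
  have hzK := hRK hzK
  have hzL := hRL hzL
  rw [mem_closedBall_zero_iff] at hz0 hzK hzL
  refine hsupp p ?_ ?_
  · calc ‖(φ p).2.1‖ = ‖(z + (φ p).2.1) - z‖ := by rw [add_sub_cancel_left]
      _ ≤ _ := (norm_sub_le _ _).trans (add_le_add hzK hz0)
  · calc ‖(φ p).2.2‖ = ‖(actU (φ p).1.1⁻¹ z + (φ p).2.2) - actU (φ p).1.1⁻¹ z‖ := by
          rw [add_sub_cancel_left]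
      _ ≤ _ := (norm_sub_le _ _).trans (add_le_add hzL (by rwa [norm_actU]))

lemma extendVal_locInter_eq (h3 : TranslationInvariant μ) (hKc : Convex ℝ K) (hKk : IsCompact K)
    (hLc : Convex ℝ L) (hLk : IsCompact L) (ε : ℝ) (b : Fin (Module.finrank ℝ (Cn n)) → Bool)
    (g h : Matrix.unitaryGroup (Fin n) ℂ) (y x : Cn n) :
    extendVal μ (locInter K L ε b g h y (actU g⁻¹ (y - x))) =
      extendVal μ (kinInter K L g x ∩ {z | actU h⁻¹ (z - y) ∈ cubeFace n ε b}) := by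
  have hcl : IsClosed {z | actU h⁻¹ (z - y) ∈ cubeFace n ε b} :=
    (isClosed_cubeFace ε b).preimage ((actIso h⁻¹).continuous.comp (by fun_prop))
  rw [← h3.extendVal_preimage_add ((convex_kinInter hKc hLc g x).inter
    (convex_preimage_actU_sub (convex_cubeFace ε b) h⁻¹ y))
    ((isCompact_kinInter hKk hLk.isClosed g x).inter_right hcl) y]
  congr 1
  ext z
  simp [mem_locInter, mem_kinInter, ← actU_add, add_sub_assoc]

lemma integral_integral_locVal (h1 : IsValuation μ) (h2 : Continuous μ)
    (h3 : TranslationInvariant μ) (h4 : UInvariant μ) (hKc : Convex ℝ K) (hKk : IsCompact K)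
    (hLc : Convex ℝ L) (hLk : IsCompact L) {ε : ℝ} (hε : 0 < ε)
    (g h : Matrix.unitaryGroup (Fin n) ℂ) :
    ∫ y, ∫ q, locVal μ K L ε g h y q =
      ε ^ Module.finrank ℝ (Cn n) * ∫ x, extendVal μ (kinInter K L g x) := by
  obtain ⟨RK, hRK⟩ := hKk.isBounded.subset_closedBall 0
  obtain ⟨RL, hRL⟩ := hLk.isBounded.subset_closedBall 0
  set r : ℝ := ε * Module.finrank ℝ (Cn n) with hr
  have hsub (y : Cn n) : ∫ q, locVal μ K L ε g h y q =
      ∫ x, locVal μ K L ε g h y (actU g⁻¹ (y - x)) := by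
    rw [← integral_comp_actU g⁻¹, ← integral_sub_left_eq_self _ volume y]
  simp only [hsub]
  rw [integral_integral_swap]
  · rw [← integral_const_mul]
    refine integral_congr_ae (ae_of_all _ fun x => ?_)
    simp only [locVal, extendVal_locInter_eq h3 hKc hKk hLc hLk]
    exact integral_extendVal_inter_cubeFace_actU h1 h2 h4 hε (convex_kinInter hKc hLc g x)
      (isCompact_kinInter hKk hLk.isClosed g x) h
  · refine integrable_locVal (φ := fun p : Cn n × Cn n => ((g, h), (p.1, actU g⁻¹ (p.1 - p.2))))
      h2 hKc hKk hLc hLk hRK hRL hε.le ?_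
      (B := Metric.closedBall 0 (RK + r) ×ˢ Metric.closedBall 0 (RK + r + (RL + r))) ?_ ?_
    · exact (continuous_const).prodMk (continuous_fst.prodMk
        (continuous_actU_comp continuous_const (by fun_prop)))
    · rw [Measure.prod_prod]
      exact ENNReal.mul_ne_top (isCompact_closedBall _ _).measure_lt_top.ne
        (isCompact_closedBall _ _).measure_lt_top.ne
    · rintro ⟨y, x⟩ hy hx
      rw [norm_actU] at hx
      refine ⟨mem_closedBall_zero_iff.2 hy, mem_closedBall_zero_iff.2 ?_⟩
      calc ‖x‖ = ‖y - (y - x)‖ := by rw [sub_sub_cancel]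
        _ ≤ _ := (norm_sub_le _ _).trans (add_le_add hy hx)

/-- The average of the local functional over the coset `SU(n) c` and all rotated cubes. -/
def locAvg (μ : ConvexBody (Cn n) → ℂ) (νSU : Measure (SUgrp n))
    (νU : Measure (Matrix.unitaryGroup (Fin n) ℂ)) (K L : Set (Cn n)) (ε : ℝ)
    (c : Matrix.unitaryGroup (Fin n) ℂ) (p : Cn n × Cn n) : ℂ :=
  ∫ s, locVal μ K L ε (s.1 * c) s.2 p.1 p.2 ∂(νSU.prod νU)

/-- The kinematic integral over the coset `SU(n) c`. -/
def cosetKin (μ : ConvexBody (Cn n) → ℂ) (νSU : Measure (SUgrp n)) (K L : Set (Cn n))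
    (c : Matrix.unitaryGroup (Fin n) ℂ) : ℂ :=
  ∫ s : SUgrp n, (∫ x, extendVal μ (kinInter K L (s * c) x)) ∂νSU

variable {νSU : Measure (SUgrp n)} [IsProbabilityMeasure νSU]
  {νU : Measure (Matrix.unitaryGroup (Fin n) ℂ)} [IsProbabilityMeasure νU]

lemma integrable_locVal_prod (h2 : Continuous μ) (hKc : Convex ℝ K) (hKk : IsCompact K)
    (hLc : Convex ℝ L) (hLk : IsCompact L) {ε : ℝ} (hε : 0 ≤ ε)
    (c : Matrix.unitaryGroup (Fin n) ℂ) :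
    Integrable (fun p : (Cn n × Cn n) × (SUgrp n × Matrix.unitaryGroup (Fin n) ℂ) =>
      locVal μ K L ε (p.2.1 * c) p.2.2 p.1.1 p.1.2)
      ((volume.prod volume).prod (νSU.prod νU)) := by
  obtain ⟨RK, hRK⟩ := hKk.isBounded.subset_closedBall 0
  obtain ⟨RL, hRL⟩ := hLk.isBounded.subset_closedBall 0
  set r : ℝ := ε * Module.finrank ℝ (Cn n) with hr
  refine integrable_locVal (φ := fun p : (Cn n × Cn n) ×
    (SUgrp n × Matrix.unitaryGroup (Fin n) ℂ) => ((p.2.1 * c, p.2.2), p.1))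
    h2 hKc hKk hLc hLk hRK hRL hε (by fun_prop)
    (B := (Metric.closedBall 0 (RK + r) ×ˢ Metric.closedBall 0 (RL + r)) ×ˢ Set.univ) ?_ ?_
  · rw [Measure.prod_prod, Measure.prod_prod, measure_univ, mul_one]
    exact ENNReal.mul_ne_top (isCompact_closedBall _ _).measure_lt_top.ne
      (isCompact_closedBall _ _).measure_lt_top.ne
  · rintro ⟨⟨y, q⟩, s⟩ hy hq
    exact ⟨⟨mem_closedBall_zero_iff.2 hy, mem_closedBall_zero_iff.2 hq⟩, Set.mem_univ _⟩

lemma integrable_locVal_slice (h2 : Continuous μ) (hKc : Convex ℝ K) (hKk : IsCompact K)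
    (hLc : Convex ℝ L) (hLk : IsCompact L) {ε : ℝ} (hε : 0 ≤ ε)
    (g h : Matrix.unitaryGroup (Fin n) ℂ) :
    Integrable (fun p : Cn n × Cn n => locVal μ K L ε g h p.1 p.2) (volume.prod volume) := by
  obtain ⟨RK, hRK⟩ := hKk.isBounded.subset_closedBall 0
  obtain ⟨RL, hRL⟩ := hLk.isBounded.subset_closedBall 0
  set r : ℝ := ε * Module.finrank ℝ (Cn n) with hr
  refine integrable_locVal (φ := fun p : Cn n × Cn n => ((g, h), p))
    h2 hKc hKk hLc hLk hRK hRL hε (by fun_prop)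
    (B := Metric.closedBall 0 (RK + r) ×ˢ Metric.closedBall 0 (RL + r)) ?_ ?_
  · rw [Measure.prod_prod]
    exact ENNReal.mul_ne_top (isCompact_closedBall _ _).measure_lt_top.ne
      (isCompact_closedBall _ _).measure_lt_top.ne
  · rintro ⟨y, q⟩ hy hq
    exact ⟨mem_closedBall_zero_iff.2 hy, mem_closedBall_zero_iff.2 hq⟩

lemma integrable_locAvg (h2 : Continuous μ) (hKc : Convex ℝ K) (hKk : IsCompact K)
    (hLc : Convex ℝ L) (hLk : IsCompact L) {ε : ℝ} (hε : 0 ≤ ε)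
    (c : Matrix.unitaryGroup (Fin n) ℂ) :
    Integrable (locAvg μ νSU νU K L ε c) (volume.prod volume) :=
  (integrable_locVal_prod h2 hKc hKk hLc hLk hε c).integral_prod_left

lemma integral_locAvg (h1 : IsValuation μ) (h2 : Continuous μ)
    (h3 : TranslationInvariant μ) (h4 : UInvariant μ) (hKc : Convex ℝ K) (hKk : IsCompact K)
    (hLc : Convex ℝ L) (hLk : IsCompact L) {ε : ℝ} (hε : 0 < ε)
    (c : Matrix.unitaryGroup (Fin n) ℂ) :
    ∫ p, locAvg μ νSU νU K L ε c p ∂(volume.prod volume) =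
      ε ^ Module.finrank ℝ (Cn n) * cosetKin μ νSU K L c := by
  simp only [locAvg]
  rw [integral_integral_swap (integrable_locVal_prod h2 hKc hKk hLc hLk hε.le c)]
  have hinner (s : SUgrp n × Matrix.unitaryGroup (Fin n) ℂ) :
      ∫ p : Cn n × Cn n, locVal μ K L ε (s.1 * c) s.2 p.1 p.2 ∂(volume.prod volume) =
        ε ^ Module.finrank ℝ (Cn n) * ∫ x, extendVal μ (kinInter K L (s.1 * c) x) := by
    rw [integral_prod _ (integrable_locVal_slice h2 hKc hKk hLc hLk hε.le _ _),
      integral_integral_locVal h1 h2 h3 h4 hKc hKk hLc hLk hε]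
  simp only [hinner]
  rw [integral_const_mul, integral_fun_fst
    (f := fun s : SUgrp n => ∫ x, extendVal μ (kinInter K L (s * c) x))]
  simp [cosetKin]

end LocalFormula

section Reflection

variable {n : ℕ}

/-- A complex reflection along a unit vector, with prescribed determinant. -/
lemma exists_unitary_det_eq {v : Cn n} (hv : ‖v‖ = 1) {α : ℂ} (hα : ‖α‖ = 1) :
    ∃ u : Matrix.unitaryGroup (Fin n) ℂ, Matrix.det (u : Matrix (Fin n) (Fin n) ℂ) = α ∧
      ∀ z : Cn n, actU u z = z + ((α - 1) * inner ℂ v z) • v := by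
  set w : Fin n → ℂ := v.ofLp with hw
  set P : Matrix (Fin n) (Fin n) ℂ := Matrix.vecMulVec w (star w) with hP
  have hvv : star w ⬝ᵥ w = 1 := by
    have h := inner_self_eq_norm_sq_to_K (𝕜 := ℂ) v
    rw [hv, EuclideanSpace.inner_eq_star_dotProduct, dotProduct_comm] at h
    simpa using h
  have hPP : P * P = P := by
    rw [hP, Matrix.vecMulVec_mul_vecMulVec, hvv, one_smul]
  have hPs : star P = P := by
    rw [hP, Matrix.star_eq_conjTranspose, Matrix.conjTranspose_vecMulVec, star_star]
  have hαα : star α * α = 1 := by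
    have := Complex.conj_mul' α
    rw [hα] at this
    simpa using this
  have hmem : 1 + (α - 1) • P ∈ Matrix.unitaryGroup (Fin n) ℂ := by
    rw [Matrix.mem_unitaryGroup_iff', star_add, star_one, star_smul, hPs]
    have : (1 + star (α - 1) • P) * (1 + (α - 1) • P) =
        1 + (star (α - 1) + (α - 1) + star (α - 1) * (α - 1)) • P := by
      rw [add_mul, mul_add, mul_add, one_mul, one_mul, mul_one, smul_mul_smul_comm, hPP, add_smul,
        add_smul]
      abel
    rw [this]
    have h0 : star (α - 1) + (α - 1) + star (α - 1) * (α - 1) = 0 := by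
      rw [star_sub, star_one]
      linear_combination hαα
    rw [h0, zero_smul, add_zero]
  refine ⟨⟨_, hmem⟩, ?_, fun z => ?_⟩
  · have : 1 + (α - 1) • P = 1 + Matrix.replicateCol Unit ((α - 1) • w) *
        Matrix.replicateRow Unit (star w) := by
      rw [← Matrix.vecMulVec_eq, Matrix.smul_vecMulVec]
    change Matrix.det (1 + (α - 1) • P) = α
    rw [this, Matrix.det_one_add_replicateCol_mul_replicateRow, dotProduct_smul, hvv]
    simp
  · ext i
    simp only [actU, Matrix.toLpLin_apply, Matrix.add_mulVec, Matrix.one_mulVec,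
      Matrix.smul_mulVec, hP, Matrix.vecMulVec_mulVec, EuclideanSpace.inner_eq_star_dotProduct,
      PiLp.add_apply, PiLp.smul_apply, Pi.add_apply, Pi.smul_apply, smul_eq_mul,
      MulOpposite.smul_eq_mul_unop, MulOpposite.unop_op]
    rw [dotProduct_comm]
    ring

end Reflection

section Invariance

variable {n : ℕ} {μ : ConvexBody (Cn n) → ℂ} {K L : Set (Cn n)} {νSU : Measure (SUgrp n)}
  [νSU.IsHaarMeasure] [IsProbabilityMeasure νSU] {νU : Measure (Matrix.unitaryGroup (Fin n) ℂ)}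
  [νU.IsHaarMeasure] [IsProbabilityMeasure νU]

lemma locAvg_eq_integral_integral (h2 : Continuous μ) (hKc : Convex ℝ K) (hKk : IsCompact K)
    (hLc : Convex ℝ L) (hLk : IsCompact L) {ε : ℝ} (hε : 0 ≤ ε)
    (c : Matrix.unitaryGroup (Fin n) ℂ) (y q : Cn n) :
    locAvg μ νSU νU K L ε c (y, q) =
      ∫ s : SUgrp n, (∫ h, locVal μ K L ε (s * c) h y q ∂νU) ∂νSU := by
  obtain ⟨RK, hRK⟩ := hKk.isBounded.subset_closedBall 0
  obtain ⟨RL, hRL⟩ := hLk.isBounded.subset_closedBall 0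
  refine integral_prod _ ?_
  exact integrable_locVal (φ := fun p : SUgrp n × Matrix.unitaryGroup (Fin n) ℂ =>
    ((p.1 * c, p.2), (y, q))) h2 hKc hKk hLc hLk hRK hRL hε (by fun_prop) (B := Set.univ)
    (measure_ne_top _ _) (fun p _ _ => Set.mem_univ p)

lemma locAvg_eq_of_left (h2 : Continuous μ) (h4 : UInvariant μ) (hKc : Convex ℝ K)
    (hKk : IsCompact K) (hLc : Convex ℝ L) (hLk : IsCompact L) {ε : ℝ} (hε : 0 ≤ ε)
    (c : Matrix.unitaryGroup (Fin n) ℂ) (y q : Cn n) {u : Matrix.unitaryGroup (Fin n) ℂ}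
    (huc : u * c ∈ SUgrp n)
    (hu : ∀ z, ‖z‖ ≤ ε * Module.finrank ℝ (Cn n) → (actU u z + y ∈ K ↔ z + y ∈ K)) :
    locAvg μ νSU νU K L ε c (y, q) = locAvg μ νSU νU K L ε 1 (y, q) := by
  have key (g h : Matrix.unitaryGroup (Fin n) ℂ) :
      locVal μ K L ε g h y q = locVal μ K L ε (u * g) (u * h) y q := by
    refine Finset.sum_congr rfl fun b _ => ?_
    rw [← h4.extendVal_preimage_actU (convex_locInter hKc hLc ε b (u * g) (u * h) y q)
      (isCompact_locInter hKk.isClosed hLk.isClosed hε b (u * g) (u * h) y q) u]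
    congr 2
    ext z
    simp only [Set.mem_preimage, mem_locInter, mul_inv_rev, actU_mul, actU_inv_actU]
    refine and_congr_left fun hz => and_congr_left fun _ => (hu z ?_).symm
    have := cubeFace_subset hε b hz
    rwa [mem_closedBall_zero_iff, norm_actU] at this
  rw [locAvg_eq_integral_integral h2 hKc hKk hLc hLk hε,
    locAvg_eq_integral_integral h2 hKc hKk hLc hLk hε]
  have hleft (s : SUgrp n) : ∫ h, locVal μ K L ε (s * c) h y q ∂νU =
      ∫ h, locVal μ K L ε (u * s * c) h y q ∂νU := by
    simp only [key (s * c), ← mul_assoc]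
    exact integral_mul_left_eq_self (fun h => locVal μ K L ε (u * s * c) h y q) u
  simp only [hleft, mul_one]
  exact integral_SUgrp_mul_mul νSU huc fun g => ∫ h, locVal μ K L ε g h y q ∂νU

lemma locAvg_eq_of_right (h2 : Continuous μ) (hKc : Convex ℝ K)
    (hKk : IsCompact K) (hLc : Convex ℝ L) (hLk : IsCompact L) {ε : ℝ} (hε : 0 ≤ ε)
    (c : Matrix.unitaryGroup (Fin n) ℂ) (y q : Cn n) {u : Matrix.unitaryGroup (Fin n) ℂ}
    (huc : u * c ∈ SUgrp n)
    (hu : ∀ z, ‖z‖ ≤ ε * Module.finrank ℝ (Cn n) → (actU u z + q ∈ L ↔ z + q ∈ L)) :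
    locAvg μ νSU νU K L ε c (y, q) = locAvg μ νSU νU K L ε 1 (y, q) := by
  have key (g h : Matrix.unitaryGroup (Fin n) ℂ) :
      locVal μ K L ε g h y q = locVal μ K L ε (g * u) h y q := by
    refine Finset.sum_congr rfl fun b _ => ?_
    congr 2
    ext z
    simp only [mem_locInter, mul_inv_rev, actU_mul]
    refine and_congr_left fun hz => and_congr_right fun _ => ?_
    rw [← hu (actU u⁻¹ (actU g⁻¹ z)), actU_actU_inv]
    have := cubeFace_subset hε b hz
    rw [mem_closedBall_zero_iff, norm_actU] at this
    rwa [norm_actU, norm_actU]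
  have hcu : c * u ∈ SUgrp n := (inferInstance : (SUgrp n).Normal).mem_comm huc
  rw [locAvg_eq_integral_integral h2 hKc hKk hLc hLk hε,
    locAvg_eq_integral_integral h2 hKc hKk hLc hLk hε]
  simp only [key (_ * c), mul_one]
  have := integral_SUgrp_mul_mul νSU (a := 1) (b := c * u) (by simpa using hcu)
    fun g => ∫ h, locVal μ K L ε g h y q ∂νU
  simpa only [one_mul, ← mul_assoc] using this

end Invariance

section Polyhedron

variable {n : ℕ}

/-- The polyhedron cut out by finitely many half-spaces `Re ⟨a, x⟩ ≤ b`. -/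
def polyhedron (s : Finset (Cn n × ℝ)) : Set (Cn n) :=
  {x | ∀ p ∈ s, (inner ℂ p.1 x).re ≤ p.2}

/-- The points close to faces of a polyhedron whose normals span `ℂⁿ`. -/
def degenerateSet (s : Finset (Cn n × ℝ)) (r : ℝ) : Set (Cn n) :=
  {y | Submodule.span ℂ
    {a | ∃ p ∈ s, p.1 = a ∧ |(inner ℂ p.1 y).re - p.2| ≤ r * ‖p.1‖} = ⊤}

lemma exists_unitary_of_notMem_degenerateSet {s : Finset (Cn n × ℝ)} {r : ℝ} {y : Cn n}
    (hy : y ∉ degenerateSet s r) (c : Matrix.unitaryGroup (Fin n) ℂ) :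
    ∃ u : Matrix.unitaryGroup (Fin n) ℂ, u * c ∈ SUgrp n ∧
      ∀ z, ‖z‖ ≤ r → (actU u z + y ∈ polyhedron s ↔ z + y ∈ polyhedron s) := by
  have hy' : (Submodule.span ℂ
      {a | ∃ p ∈ s, p.1 = a ∧ |(inner ℂ p.1 y).re - p.2| ≤ r * ‖p.1‖})ᗮ ≠ ⊥ :=
    fun h => hy (Submodule.orthogonal_eq_bot_iff.1 h)
  obtain ⟨v₀, hv₀, hv₀0⟩ := Submodule.exists_mem_ne_zero_of_ne_bot hy'
  set v : Cn n := ((‖v₀‖⁻¹ : ℝ) : ℂ) • v₀ with hv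
  have hvn : ‖v‖ = 1 := by
    rw [hv, norm_smul, Complex.norm_real, norm_inv, norm_norm,
      inv_mul_cancel₀ (norm_ne_zero_iff.2 hv₀0)]
  have hvorth := Submodule.smul_mem _ ((‖v₀‖⁻¹ : ℝ) : ℂ) hv₀
  rw [← hv] at hvorth
  have hc1 : ‖Matrix.det (c : Matrix (Fin n) (Fin n) ℂ)‖ = 1 :=
    CStarRing.norm_of_mem_unitary (Matrix.det_of_mem_unitary c.2)
  obtain ⟨u, hu, huz⟩ := exists_unitary_det_eq hvn
    (α := (Matrix.det (c : Matrix (Fin n) (Fin n) ℂ))⁻¹) (by rw [norm_inv, hc1, inv_one])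
  refine ⟨u, ?_, fun z hz => ?_⟩
  · change Matrix.det ((u * c : Matrix.unitaryGroup (Fin n) ℂ) : Matrix (Fin n) (Fin n) ℂ) = 1
    rw [Matrix.UnitaryGroup.mul_val, Matrix.det_mul, hu]
    exact inv_mul_cancel₀ (norm_ne_zero_iff.1 (by rw [hc1]; exact one_ne_zero))
  · refine forall₂_congr fun p hp => ?_
    by_cases hact : |(inner ℂ p.1 y).re - p.2| ≤ r * ‖p.1‖
    · have h0 : inner ℂ p.1 v = 0 :=
        (Submodule.mem_orthogonal _ _).1 hvorth _ (Submodule.subset_span ⟨p, hp, rfl, hact⟩)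
      rw [huz, inner_add_right, inner_add_right, inner_smul_right, h0, mul_zero, add_zero,
        inner_add_right]
    · have hbound (w : Cn n) (hw : ‖w‖ ≤ r) : |(inner ℂ p.1 w).re| ≤ r * ‖p.1‖ := by
        refine (Complex.abs_re_le_norm _).trans ((norm_inner_le_norm _ _).trans ?_)
        rw [mul_comm]
        gcongr
      have h1 := hbound z hz
      have h2 := hbound (actU u z) (by rwa [norm_actU])
      rw [inner_add_right, inner_add_right, Complex.add_re, Complex.add_re]
      rw [abs_le] at h1 h2
      rw [not_le, lt_abs] at hact
      constructor <;> intro h <;> rcases hact with h' | h' <;> linarith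

end Polyhedron

section Degenerate

variable {n : ℕ}

/-- The real coordinates of `y ↦ ⟨a j, y⟩`, for a complex basis `a`. -/
lemma exists_continuousLinearEquiv_inner {a : Fin n → Cn n} (ha : LinearIndependent ℂ a) :
    ∃ Φ : Cn n ≃L[ℝ] (Fin n → ℝ) × (Fin n → ℝ), ∀ y,
      Φ y = (fun j => (inner ℂ (a j) y).re, fun j => (inner ℂ (a j) y).im) := by
  let φ : Cn n →ₗ[ℝ] (Fin n → ℝ) × (Fin n → ℝ) :=
    { toFun := fun y => (fun j => (inner ℂ (a j) y).re, fun j => (inner ℂ (a j) y).im)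
      map_add' := fun x y => by ext j <;> simp
      map_smul' := fun t y => by
        ext j <;> simp [inner_smul_right_eq_smul] }
  have hinj : Function.Injective φ := by
    rw [injective_iff_map_eq_zero]
    intro y hy
    have hspan := ha.span_eq_top_of_card_eq_finrank' (by simp)
    have h0 (j : Fin n) : inner ℂ (a j) y = 0 :=
      Complex.ext (congrFun (congrArg Prod.fst hy) j) (congrFun (congrArg Prod.snd hy) j)
    have hmem : y ∈ (Submodule.span ℂ (Set.range a))ᗮ := by
      refine (Submodule.mem_orthogonal _ _).2 fun u hu => ?_
      induction hu using Submodule.span_induction with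
      | mem x hx => obtain ⟨j, rfl⟩ := hx; exact h0 j
      | zero => exact inner_zero_left _
      | add x z _ _ hx hz => rw [inner_add_left, hx, hz, add_zero]
      | smul t x _ hx => rw [inner_smul_left, hx, mul_zero]
    rw [hspan, Submodule.top_orthogonal_eq_bot] at hmem
    exact (Submodule.mem_bot ℂ).1 hmem
  have hdim : Module.finrank ℝ (Cn n) = Module.finrank ℝ ((Fin n → ℝ) × (Fin n → ℝ)) := by
    rw [finrank_real_of_complex, Module.finrank_prod]
    simp
    ring
  exact ⟨(LinearEquiv.ofInjectiveOfFinrankEq φ hinj hdim).toContinuousLinearEquiv, fun y => rfl⟩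

lemma exists_volume_slabs_le {a : Fin n → Cn n} (ha : LinearIndependent ℂ a) (b : Fin n → ℝ)
    {R : ℝ} (hR : 0 ≤ R) :
    ∃ C : ℝ, 0 ≤ C ∧ ∀ r : ℝ, 0 ≤ r →
      volume {y : Cn n | ‖y‖ ≤ R ∧ ∀ j, |(inner ℂ (a j) y).re - b j| ≤ r * ‖a j‖} ≤
        ENNReal.ofReal (C * r ^ n) := by
  obtain ⟨Φ, hΦ⟩ := exists_continuousLinearEquiv_inner ha
  set A : ℝ := ∑ j, ‖a j‖ with hA
  have hA0 : 0 ≤ A := Finset.sum_nonneg fun j _ => norm_nonneg _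
  have haA (j : Fin n) : ‖a j‖ ≤ A :=
    Finset.single_le_sum (f := fun j => ‖a j‖) (fun j _ => norm_nonneg _) (Finset.mem_univ j)
  have : (volume : Measure ((Fin n → ℝ) × (Fin n → ℝ))).IsAddHaarMeasure :=
    Measure.prod.instIsAddHaarMeasure (volume : Measure (Fin n → ℝ)) (volume : Measure (Fin n → ℝ))
  have : (Measure.map Φ volume).IsAddHaarMeasure := Φ.isAddHaarMeasure_map _
  obtain ⟨κ, hκ⟩ : ∃ κ : ℝ≥0∞, κ ≠ ∞ ∧ (volume : Measure (Cn n)).map Φ = κ • volume :=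
    ⟨_, ENNReal.coe_ne_top, Measure.isAddLeftInvariant_eq_smul _ _⟩
  refine ⟨κ.toReal * (2 * A) ^ n * (2 * (R * A)) ^ n, by positivity, fun r hr => ?_⟩
  calc volume {y : Cn n | ‖y‖ ≤ R ∧ ∀ j, |(inner ℂ (a j) y).re - b j| ≤ r * ‖a j‖}
      ≤ volume (Φ ⁻¹' (Metric.closedBall b (r * A) ×ˢ Metric.closedBall 0 (R * A))) := by
        refine measure_mono fun y hy => ?_
        obtain ⟨hyR, hy⟩ := hy
        rw [Set.mem_preimage, hΦ]
        refine ⟨?_, ?_⟩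
        · rw [mem_closedBall_iff_norm, pi_norm_le_iff_of_nonneg (by positivity)]
          exact fun j => (hy j).trans (mul_le_mul_of_nonneg_left (haA j) hr)
        · rw [mem_closedBall_zero_iff, pi_norm_le_iff_of_nonneg (by positivity)]
          intro j
          refine (Complex.abs_im_le_norm _).trans ((norm_inner_le_norm _ _).trans ?_)
          rw [mul_comm]
          exact mul_le_mul hyR (haA j) (norm_nonneg _) hR
    _ = κ * (ENNReal.ofReal ((2 * (r * A)) ^ n) * ENNReal.ofReal ((2 * (R * A)) ^ n)) := by
        rw [← Measure.map_apply Φ.continuous.measurable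
          (Metric.isClosed_closedBall.prod Metric.isClosed_closedBall).measurableSet, hκ.2,
          Measure.smul_apply, Measure.volume_eq_prod, Measure.prod_prod,
          Real.volume_pi_closedBall _ (by positivity), Real.volume_pi_closedBall _ (by positivity),
          Fintype.card_fin, smul_eq_mul]
    _ = ENNReal.ofReal (κ.toReal * (2 * A) ^ n * (2 * (R * A)) ^ n * r ^ n) := by
        rw [← ENNReal.ofReal_mul (by positivity), ← ENNReal.ofReal_toReal hκ.1,
          ← ENNReal.ofReal_mul (by positivity), ENNReal.toReal_ofReal ENNReal.toReal_nonneg]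
        congr 1
        ring
    _ ≤ _ := le_rfl

lemma exists_linearIndependent_of_mem_degenerateSet {s : Finset (Cn n × ℝ)} {r : ℝ} {y : Cn n}
    (hy : y ∈ degenerateSet s r) :
    ∃ τ : Fin n → s, LinearIndependent ℂ (fun j => (τ j).1.1) ∧
      ∀ j, |(inner ℂ (τ j).1.1 y).re - (τ j).1.2| ≤ r * ‖(τ j).1.1‖ := by
  obtain ⟨B, hB, hspan, hli⟩ := exists_linearIndependent ℂ
    {a | ∃ p ∈ s, p.1 = a ∧ |(inner ℂ p.1 y).re - p.2| ≤ r * ‖p.1‖}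
  have htop : Submodule.span ℂ B = ⊤ := hspan.trans hy
  have hfin : Finite B := hli.finite
  have : Fintype B := Fintype.ofFinite B
  have hcard : Fintype.card B = n := by
    have h := finrank_span_eq_card hli
    rw [Subtype.range_coe, htop, finrank_top, finrank_euclideanSpace_fin] at h
    exact h.symm
  let e : Fin n ≃ B := (Fintype.equivFinOfCardEq hcard).symm
  choose p hps hpa hpy using fun j : Fin n => hB (e j).2
  refine ⟨fun j => ⟨p j, hps j⟩, ?_, hpy⟩
  simp only [hpa]
  exact hli.comp e e.injective

lemma exists_volume_degenerateSet_le (s : Finset (Cn n × ℝ)) {R : ℝ} (hR : 0 ≤ R) :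
    ∃ C : ℝ, 0 ≤ C ∧ ∀ r : ℝ, 0 ≤ r → ∃ Y : Set (Cn n), MeasurableSet Y ∧
      (∀ y ∈ degenerateSet s r, ‖y‖ ≤ R → y ∈ Y) ∧ volume Y ≤ ENNReal.ofReal (C * r ^ n) := by
  let Z (r : ℝ) (τ : Fin n → s) : Set (Cn n) :=
    {y | ‖y‖ ≤ R ∧ ∀ j, |(inner ℂ (τ j).1.1 y).re - (τ j).1.2| ≤ r * ‖(τ j).1.1‖}
  let I := {τ : Fin n → s // LinearIndependent ℂ (fun j => (τ j).1.1)}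
  have : Fintype I := Fintype.ofFinite I
  choose C hC0 hC using fun τ : I => exists_volume_slabs_le τ.2 (fun j => (τ.1 j).1.2) hR
  refine ⟨∑ τ, C τ, Finset.sum_nonneg fun τ _ => hC0 τ, fun r hr => ⟨⋃ τ : I, Z r τ.1, ?_, ?_, ?_⟩⟩
  · refine MeasurableSet.iUnion fun τ => IsClosed.measurableSet ?_
    simp only [Z, Set.ofPred_and, Set.ofPred_forall]
    exact (isClosed_le (by fun_prop) (by fun_prop)).inter
      (isClosed_iInter fun j => isClosed_le (by fun_prop) (by fun_prop))
  · intro y hy hyR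
    obtain ⟨τ, hτ, hτy⟩ := exists_linearIndependent_of_mem_degenerateSet hy
    exact Set.mem_iUnion.2 ⟨⟨τ, hτ⟩, hyR, hτy⟩
  · refine (measure_iUnion_fintype_le _ _).trans ?_
    rw [Finset.sum_mul, ENNReal.ofReal_sum_of_nonneg fun τ _ => mul_nonneg (hC0 τ) (by positivity)]
    exact Finset.sum_le_sum fun τ _ => hC τ r hr

end Degenerate

section Polytope

variable {n : ℕ} {μ : ConvexBody (Cn n) → ℂ} {K L : Set (Cn n)} {νSU : Measure (SUgrp n)}
  {νU : Measure (Matrix.unitaryGroup (Fin n) ℂ)}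

lemma locInter_eq_empty {RK RL ε : ℝ} (hRK : K ⊆ Metric.closedBall 0 RK)
    (hRL : L ⊆ Metric.closedBall 0 RL) (hε : 0 ≤ ε)
    (b : Fin (Module.finrank ℝ (Cn n)) → Bool) (g h : Matrix.unitaryGroup (Fin n) ℂ) {y q : Cn n}
    (hyq : RK + ε * Module.finrank ℝ (Cn n) < ‖y‖ ∨ RL + ε * Module.finrank ℝ (Cn n) < ‖q‖) :
    locInter K L ε b g h y q = ∅ := by
  refine Set.eq_empty_of_forall_notMem fun z hz => ?_
  have hz0 := locInter_subset hε b _ _ _ _ hz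
  obtain ⟨⟨hzK, hzL⟩, -⟩ := hz
  have hzK := hRK hzK
  have hzL := hRL hzL
  rw [mem_closedBall_zero_iff] at hz0 hzK hzL
  rcases hyq with hy | hq
  · refine hy.not_ge ?_
    calc ‖y‖ = ‖(z + y) - z‖ := by rw [add_sub_cancel_left]
      _ ≤ _ := (norm_sub_le _ _).trans (add_le_add hzK hz0)
  · refine hq.not_ge ?_
    calc ‖q‖ = ‖(actU g⁻¹ z + q) - actU g⁻¹ z‖ := by rw [add_sub_cancel_left]
      _ ≤ _ := (norm_sub_le _ _).trans (add_le_add hzL (by rwa [norm_actU]))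

lemma locAvg_eq_zero {RK RL ε : ℝ} (hRK : K ⊆ Metric.closedBall 0 RK)
    (hRL : L ⊆ Metric.closedBall 0 RL) (hε : 0 ≤ ε) (c : Matrix.unitaryGroup (Fin n) ℂ)
    {y q : Cn n} (hyq : RK + ε * Module.finrank ℝ (Cn n) < ‖y‖ ∨
      RL + ε * Module.finrank ℝ (Cn n) < ‖q‖) :
    locAvg μ νSU νU K L ε c (y, q) = 0 := by
  simp [locAvg, locVal, locInter_eq_empty hRK hRL hε _ _ _ hyq, extendVal_empty]

lemma polyhedron_eq_biInter (s : Finset (Cn n × ℝ)) :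
    polyhedron s = ⋂ p ∈ s, {x | (inner ℂ p.1 x).re ≤ p.2} := by
  ext x
  simp [polyhedron]

lemma convex_polyhedron (s : Finset (Cn n × ℝ)) : Convex ℝ (polyhedron s) := by
  rw [polyhedron_eq_biInter]
  refine convex_iInter₂ fun p _ => convex_halfSpace_le ⟨fun x y => ?_, fun t x => ?_⟩ _
  · rw [inner_add_right, Complex.add_re]
  · rw [inner_smul_right_eq_smul, Complex.smul_re]

variable [IsProbabilityMeasure νSU]

lemma Homogeneous.exists_norm_locAvg_le [IsProbabilityMeasure νU] {k : ℕ}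
    (h5 : Homogeneous k μ) (h2 : Continuous μ) (hKc : Convex ℝ K) (hKk : IsCompact K)
    (hLc : Convex ℝ L) (hLk : IsCompact L) :
    ∃ M : ℝ, 0 ≤ M ∧ ∀ ε : ℝ, 0 < ε → ∀ c p, ‖locAvg μ νSU νU K L ε c p‖ ≤ M * ε ^ k := by
  obtain ⟨M, hM0, hM⟩ := h5.exists_norm_extendVal_le h2 (Module.finrank ℝ (Cn n))
  refine ⟨∑ _b : Fin (Module.finrank ℝ (Cn n)) → Bool, M, Finset.sum_nonneg fun _ _ => hM0,
    fun ε hε c p => ?_⟩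
  rw [Finset.sum_mul]
  have hloc (s : SUgrp n × Matrix.unitaryGroup (Fin n) ℂ) :
      ‖locVal μ K L ε (s.1 * c) s.2 p.1 p.2‖ ≤
        ∑ _b : Fin (Module.finrank ℝ (Cn n)) → Bool, M * ε ^ k := by
    refine norm_sum_le_of_le _ fun b _ => ?_
    rw [norm_mul, norm_boolSign, one_mul]
    exact hM ε hε _ (convex_locInter hKc hLc ε b _ _ _ _)
      (isCompact_locInter hKk.isClosed hLk.isClosed hε.le b _ _ _ _)
      (locInter_subset hε.le b _ _ _ _)
  refine (norm_integral_le_of_norm_le_const (ae_of_all _ hloc)).trans_eq ?_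
  rw [probReal_univ, mul_one]

lemma cosetKin_polyhedron [νSU.IsHaarMeasure] (νU : Measure (Matrix.unitaryGroup (Fin n) ℂ))
    [νU.IsHaarMeasure] [IsProbabilityMeasure νU] {k : ℕ} (hk : 0 < k) (h1 : IsValuation μ)
    (h2 : Continuous μ) (h3 : TranslationInvariant μ) (h4 : UInvariant μ) (h5 : Homogeneous k μ)
    {s t : Finset (Cn n × ℝ)} (hs : IsCompact (polyhedron s)) (ht : IsCompact (polyhedron t))
    (c : Matrix.unitaryGroup (Fin n) ℂ) :
    cosetKin μ νSU (polyhedron s) (polyhedron t) c =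
      cosetKin μ νSU (polyhedron s) (polyhedron t) 1 := by
  set K := polyhedron s
  set L := polyhedron t
  have hKc : Convex ℝ K := convex_polyhedron s
  have hLc : Convex ℝ L := convex_polyhedron t
  obtain ⟨RK, hRK0, hRK⟩ := hs.isBounded.subset_closedBall_lt 0 0
  obtain ⟨RL, hRL0, hRL⟩ := ht.isBounded.subset_closedBall_lt 0 0
  obtain ⟨M, hM0, hM⟩ := h5.exists_norm_locAvg_le (νSU := νSU) (νU := νU) h2 hKc hs hLc ht
  set N : ℕ := Module.finrank ℝ (Cn n) with hN
  have hN2 : N = n + n := by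
    rw [hN, finrank_real_of_complex, finrank_euclideanSpace_fin, two_mul]
  obtain ⟨CK, hCK0, hCK⟩ := exists_volume_degenerateSet_le s (R := RK + N) (by positivity)
  obtain ⟨CL, hCL0, hCL⟩ := exists_volume_degenerateSet_le t (R := RL + N) (by positivity)
  set F := cosetKin μ νSU K L
  have hbound (ε : ℝ) (hε : 0 < ε) (hε1 : ε ≤ 1) :
      ‖F c - F 1‖ ≤ (2 * M * (CK * N ^ n) * (CL * N ^ n)) * ε ^ k := by
    obtain ⟨YK, hYKm, hYK, hYKv⟩ := hCK (ε * N) (by positivity)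
    obtain ⟨YL, hYLm, hYL, hYLv⟩ := hCL (ε * N) (by positivity)
    have hεN : ε * N ≤ N := mul_le_of_le_one_left (Nat.cast_nonneg N) hε1
    have hvol (Y : Set (Cn n)) (C : ℝ) (hC : 0 ≤ C)
        (hY : volume Y ≤ ENNReal.ofReal (C * (ε * N) ^ n)) :
        volume.real Y ≤ C * (ε * N) ^ n :=
      ENNReal.toReal_le_of_le_ofReal (by positivity) hY
    have hout (p : Cn n × Cn n) (hp : p ∉ YK ×ˢ YL) :
        locAvg μ νSU νU K L ε c p - locAvg μ νSU νU K L ε 1 p = 0 := by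
      obtain ⟨y, q⟩ := p
      rw [sub_eq_zero]
      by_cases hlarge : RK + ε * N < ‖y‖ ∨ RL + ε * N < ‖q‖
      · rw [locAvg_eq_zero hRK hRL hε.le c hlarge, locAvg_eq_zero hRK hRL hε.le 1 hlarge]
      · rw [not_or, not_lt, not_lt] at hlarge
        rw [Set.mem_prod, not_and_or] at hp
        rcases hp with hp | hp
        · obtain ⟨u, huc, hu⟩ := exists_unitary_of_notMem_degenerateSet
            (fun h => hp (hYK y h (hlarge.1.trans (by gcongr)))) c
          exact locAvg_eq_of_left h2 h4 hKc hs hLc ht hε.le c y q huc hu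
        · obtain ⟨u, huc, hu⟩ := exists_unitary_of_notMem_degenerateSet
            (fun h => hp (hYL q h (hlarge.2.trans (by gcongr)))) c
          exact locAvg_eq_of_right h2 hKc hs hLc ht hε.le c y q huc hu
    have hint : ε ^ N * (F c - F 1) = ∫ p in YK ×ˢ YL,
        (locAvg μ νSU νU K L ε c p - locAvg μ νSU νU K L ε 1 p) ∂(volume.prod volume) := by
      rw [setIntegral_eq_integral_of_forall_compl_eq_zero hout,
        integral_sub (integrable_locAvg h2 hKc hs hLc ht hε.le c)
          (integrable_locAvg h2 hKc hs hLc ht hε.le 1),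
        integral_locAvg h1 h2 h3 h4 hKc hs hLc ht hε, integral_locAvg h1 h2 h3 h4 hKc hs hLc ht hε,
        mul_sub]
    have hnorm : ε ^ N * ‖F c - F 1‖ ≤
        2 * (M * ε ^ k) * ((CK * (ε * N) ^ n) * (CL * (ε * N) ^ n)) := by
      calc ε ^ N * ‖F c - F 1‖ = ‖(ε : ℂ) ^ N * (F c - F 1)‖ := by
            rw [norm_mul, norm_pow, Complex.norm_real, Real.norm_of_nonneg hε.le]
        _ ≤ 2 * (M * ε ^ k) * ((volume.prod volume).real (YK ×ˢ YL)) := by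
            rw [hint]
            refine norm_setIntegral_le_of_norm_le_const ?_ fun p _ => ?_
            · rw [Measure.prod_prod]
              exact ENNReal.mul_lt_top (hYKv.trans_lt ENNReal.ofReal_lt_top)
                (hYLv.trans_lt ENNReal.ofReal_lt_top)
            · rw [two_mul]
              exact (norm_sub_le _ _).trans (add_le_add (hM ε hε c p) (hM ε hε 1 p))
        _ ≤ _ := by
            rw [measureReal_prod_prod]
            gcongr
            · exact hvol YK CK hCK0 hYKv
            · exact hvol YL CL hCL0 hYLv
    refine le_of_mul_le_mul_left (hnorm.trans_eq ?_) (pow_pos hε N)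
    rw [hN2, pow_add, mul_pow]
    ring
  have hlim : Tendsto (fun ε : ℝ => (2 * M * (CK * N ^ n) * (CL * N ^ n)) * ε ^ k)
      (𝓝[>] 0) (𝓝 0) := by
    have : Continuous fun ε : ℝ => (2 * M * (CK * N ^ n) * (CL * N ^ n)) * ε ^ k := by fun_prop
    have := (this.tendsto 0).mono_left (nhdsWithin_le_nhds (s := Set.Ioi 0))
    simpa [zero_pow hk.ne'] using this
  refine sub_eq_zero.1 (norm_le_zero_iff.1 (ge_of_tendsto hlim ?_))
  filter_upwards [Ioc_mem_nhdsGT (zero_lt_one' ℝ)] with ε hε using hbound ε hε.1 hε.2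

end Polytope

section Approximation

variable {n : ℕ}

lemma polyhedron_anti {s t : Finset (Cn n × ℝ)} (h : s ⊆ t) : polyhedron t ⊆ polyhedron s :=
  fun _ hx p hp => hx p (h hp)

lemma isClosed_polyhedron (s : Finset (Cn n × ℝ)) : IsClosed (polyhedron s) := by
  rw [polyhedron_eq_biInter]
  exact isClosed_biInter fun p _ => isClosed_le (by fun_prop) continuous_const

/-- A compact polyhedron containing the ball of radius `R`. -/
lemma exists_isCompact_polyhedron (n : ℕ) (R : ℝ) :
    ∃ s : Finset (Cn n × ℝ), IsCompact (polyhedron s) ∧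
      Metric.closedBall 0 R ⊆ polyhedron s := by
  classical
  let s : Finset (Cn n × ℝ) := (Finset.univ ×ˢ ({1, -1, Complex.I, -Complex.I} : Finset ℂ)).image
    fun p : Fin n × ℂ => (EuclideanSpace.single p.1 p.2, R)
  refine ⟨s, ?_, ?_⟩
  · refine ((isCompact_closedBall (0 : Fin n → ℂ) (|R| + |R|)).image
      (PiLp.continuous_toLp 2 _)).of_isClosed_subset (isClosed_polyhedron s) fun x hx => ?_
    refine ⟨x.ofLp, ?_, rfl⟩
    have key (j : Fin n) (c : ℂ) (hc : c ∈ ({1, -1, Complex.I, -Complex.I} : Finset ℂ)) :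
        ((starRingEnd ℂ) c * x j).re ≤ R := by
      have := hx (EuclideanSpace.single j c, R)
        (Finset.mem_image.2 ⟨(j, c), by simpa using hc, rfl⟩)
      simpa only [EuclideanSpace.inner_single_left] using this
    have hbd (j : Fin n) : |(x j).re| ≤ R ∧ |(x j).im| ≤ R := by
      have h1 := key j 1 (by simp)
      have h2 := key j (-1) (by simp)
      have h3 := key j Complex.I (by simp)
      have h4 := key j (-Complex.I) (by simp)
      simp at h1 h2 h3 h4
      constructor <;> rw [abs_le] <;> constructor <;> linarith
    rw [mem_closedBall_zero_iff, pi_norm_le_iff_of_nonneg (by positivity)]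
    exact fun j => (Complex.norm_le_abs_re_add_abs_im _).trans
      (add_le_add ((hbd j).1.trans (le_abs_self R)) ((hbd j).2.trans (le_abs_self R)))
  · intro x hx p hp
    obtain ⟨⟨j, c⟩, hc, rfl⟩ := Finset.mem_image.1 hp
    have hc1 : ‖c‖ = 1 := by
      simp at hc
      rcases hc with rfl | rfl | rfl | rfl <;> simp
    refine (Complex.re_le_norm _).trans ((norm_inner_le_norm _ _).trans ?_)
    rw [PiLp.norm_single, hc1, one_mul]
    exact mem_closedBall_zero_iff.1 hx

lemma exists_polyhedron_approx {K : Set (Cn n)} (hKc : Convex ℝ K) (hKk : IsCompact K) :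
    ∃ s : ℕ → Finset (Cn n × ℝ), (∀ i, IsCompact (polyhedron (s i))) ∧
      Antitone (fun i => polyhedron (s i)) ∧ ⋂ i, polyhedron (s i) = K := by
  classical
  obtain ⟨R, hR⟩ := hKk.isBounded.subset_closedBall 0
  obtain ⟨s₀, hs₀, hs₀R⟩ := exists_isCompact_polyhedron n R
  let D : Set (Cn n × ℝ) := {p | ∀ x ∈ K, (inner ℂ p.1 x).re ≤ p.2}
  obtain ⟨D', hD'D, hD'c, hD'⟩ : ∃ D' ⊆ D, D'.Countable ∧
      ⋃ p ∈ D', {x | p.2 < (inner ℂ p.1 x).re} = ⋃ p ∈ D, {x | p.2 < (inner ℂ p.1 x).re} := by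
    obtain ⟨T, hTD, hT, h⟩ := isOpen_biUnion_countable D
      (fun p => {x | p.2 < (inner ℂ p.1 x).re})
      fun p _ => isOpen_lt continuous_const (by fun_prop)
    exact ⟨T, hTD, hT, h⟩
  have h0 : ((0, 0) : Cn n × ℝ) ∈ D := fun x _ => by simp
  obtain ⟨f, hf⟩ := (hD'c.insert (0, 0)).exists_eq_range (Set.insert_nonempty _ _)
  have hfD (i : ℕ) : f i ∈ D := by
    rcases hf.symm ▸ Set.mem_range_self (f := f) i with h | h
    · rwa [h]
    · exact hD'D h
  refine ⟨fun i => s₀ ∪ (Finset.range i).image f, fun i => ?_, fun i j hij => ?_, ?_⟩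
  · exact hs₀.of_isClosed_subset (isClosed_polyhedron _)
      (polyhedron_anti Finset.subset_union_left)
  · exact polyhedron_anti (Finset.union_subset_union_right
      (Finset.image_subset_image (Finset.range_mono hij)))
  · refine Set.Subset.antisymm (fun x hx => ?_) (fun x hx => Set.mem_iInter.2 fun i p hp => ?_)
    · by_contra hxK
      obtain ⟨F, b, hFK, hFx⟩ := RCLike.geometric_hahn_banach_closed_point (𝕜 := ℂ) hKc
        hKk.isClosed hxK
      have hx' : x ∈ ⋃ p ∈ D, {x | p.2 < (inner ℂ p.1 x).re} := by
        refine Set.mem_biUnion (x := ((InnerProductSpace.toDual ℂ (Cn n)).symm F, b)) ?_ ?_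
        · intro z hz
          rw [InnerProductSpace.toDual_symm_apply]
          exact (hFK z hz).le
        · rw [Set.mem_ofPred_eq, InnerProductSpace.toDual_symm_apply]
          exact hFx
      rw [← hD'] at hx'
      obtain ⟨p, hp, hpx⟩ := Set.mem_iUnion₂.1 hx'
      obtain ⟨i, rfl⟩ : p ∈ Set.range f := hf ▸ Set.mem_insert_of_mem _ hp
      refine (Set.mem_iInter.1 hx (i + 1) (f i) ?_).not_gt hpx
      exact Finset.mem_union_right _ (Finset.mem_image_of_mem f (Finset.self_mem_range_succ i))
    · rcases Finset.mem_union.1 hp with hp | hp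
      · exact hs₀R (hR hx) p hp
      · obtain ⟨j, -, rfl⟩ := Finset.mem_image.1 hp
        exact hfD j x hx

end Approximation

section Limit

variable {n : ℕ} {μ : ConvexBody (Cn n) → ℂ} {K L : Set (Cn n)}

lemma norm_le_of_mem_kinInter {RK RL : ℝ} (hRK : K ⊆ Metric.closedBall 0 RK)
    (hRL : L ⊆ Metric.closedBall 0 RL) {g : Matrix.unitaryGroup (Fin n) ℂ} {x z : Cn n}
    (hz : z ∈ kinInter K L g x) : ‖x‖ ≤ RK + RL := by
  have hzK := mem_closedBall_zero_iff.1 (hRK hz.1)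
  have hzL := mem_closedBall_zero_iff.1 (hRL hz.2)
  rw [norm_actU] at hzL
  calc ‖x‖ = ‖z - (z - x)‖ := by rw [sub_sub_cancel]
    _ ≤ _ := (norm_sub_le _ _).trans (add_le_add hzK hzL)

lemma integrable_extendVal_kinInter (h2 : Continuous μ) (hKc : Convex ℝ K) (hKk : IsCompact K)
    (hLc : Convex ℝ L) (hLk : IsCompact L) {X : Type*} [TopologicalSpace X] [MeasurableSpace X]
    [OpensMeasurableSpace X] [SecondCountableTopologyEither X (Cn n)]
    (ν : Measure X) [IsFiniteMeasure ν]
    {φ : X → Matrix.unitaryGroup (Fin n) ℂ} (hφ : Continuous φ) :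
    Integrable (fun p : X × Cn n => extendVal μ (kinInter K L (φ p.1) p.2))
      (ν.prod volume) := by
  obtain ⟨RK, hRK⟩ := hKk.isBounded.subset_closedBall 0
  obtain ⟨RL, hRL⟩ := hLk.isBounded.subset_closedBall 0
  refine integrable_extendVal_of_isClosed_graph h2 hKk _ (fun p => Set.inter_subset_left)
    (fun p => convex_kinInter hKc hLc _ _)
    ((isClosed_kinInter_graph hKk.isClosed hLk.isClosed).preimage
      (f := fun p : (X × Cn n) × Cn n => ((φ p.1.1, p.1.2), p.2)) (by fun_prop))
    (B := Set.univ ×ˢ Metric.closedBall 0 (RK + RL)) ?_ ?_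
  · rw [Measure.prod_prod]
    exact ENNReal.mul_ne_top (measure_ne_top _ _) (isCompact_closedBall _ _).measure_lt_top.ne
  · rintro ⟨s, x⟩ z hz
    exact ⟨Set.mem_univ s, mem_closedBall_zero_iff.2 (norm_le_of_mem_kinInter hRK hRL hz)⟩

variable {νSU : Measure (SUgrp n)} [IsProbabilityMeasure νSU]

lemma cosetKin_eq_integral_prod (h2 : Continuous μ) (hKc : Convex ℝ K) (hKk : IsCompact K)
    (hLc : Convex ℝ L) (hLk : IsCompact L) (c : Matrix.unitaryGroup (Fin n) ℂ) :
    cosetKin μ νSU K L c =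
      ∫ p : SUgrp n × Cn n, extendVal μ (kinInter K L (p.1 * c) p.2) ∂(νSU.prod volume) :=
  (integral_prod _ (integrable_extendVal_kinInter h2 hKc hKk hLc hLk νSU
    (φ := fun s : SUgrp n => s * c) (by fun_prop))).symm

lemma tendsto_cosetKin (h2 : Continuous μ) {P Q : ℕ → Set (Cn n)} (hP : Antitone P)
    (hPc : ∀ i, Convex ℝ (P i)) (hPk : ∀ i, IsCompact (P i)) (hQ : Antitone Q)
    (hQc : ∀ i, Convex ℝ (Q i)) (hQk : ∀ i, IsCompact (Q i))
    (c : Matrix.unitaryGroup (Fin n) ℂ) :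
    Tendsto (fun i => cosetKin μ νSU (P i) (Q i) c) atTop
      (𝓝 (cosetKin μ νSU (⋂ i, P i) (⋂ i, Q i) c)) := by
  obtain ⟨RP, hRP⟩ := (hPk 0).isBounded.subset_closedBall 0
  obtain ⟨RQ, hRQ⟩ := (hQk 0).isBounded.subset_closedBall 0
  obtain ⟨M, hM0, hM⟩ := exists_norm_extendVal_le h2 RP
  rw [cosetKin_eq_integral_prod h2 (convex_iInter hPc)
    ((hPk 0).of_isClosed_subset (isClosed_iInter fun i => (hPk i).isClosed) (Set.iInter_subset P 0))
    (convex_iInter hQc)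
    ((hQk 0).of_isClosed_subset (isClosed_iInter fun i => (hQk i).isClosed)
      (Set.iInter_subset Q 0))]
  simp only [fun i => cosetKin_eq_integral_prod (νSU := νSU) h2 (hPc i) (hPk i) (hQc i) (hQk i) c]
  have hRPi (i : ℕ) : P i ⊆ Metric.closedBall 0 RP := (hP (Nat.zero_le i)).trans hRP
  have hRQi (i : ℕ) : Q i ⊆ Metric.closedBall 0 RQ := (hQ (Nat.zero_le i)).trans hRQ
  refine tendsto_integral_of_dominated_convergence
    ((Set.univ ×ˢ Metric.closedBall 0 (RP + RQ)).indicator fun _ => M) (fun i => ?_) ?_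
    (fun i => ae_of_all _ fun p => ?_) (ae_of_all _ fun p => ?_)
  · exact (integrable_extendVal_kinInter h2 (hPc i) (hPk i) (hQc i) (hQk i) νSU
      (φ := fun s : SUgrp n => s * c) (by fun_prop)).aestronglyMeasurable
  · refine (integrable_indicator_iff
      (MeasurableSet.univ.prod Metric.isClosed_closedBall.measurableSet)).2
      (integrableOn_const ?_)
    rw [Measure.prod_prod, measure_univ, one_mul]
    exact (isCompact_closedBall _ _).measure_lt_top.ne
  · by_cases hp : p ∈ (Set.univ : Set (SUgrp n)) ×ˢ Metric.closedBall (0 : Cn n) (RP + RQ)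
    · rw [Set.indicator_of_mem hp]
      exact hM _ (Set.inter_subset_left.trans (hRPi i))
    · rw [Set.indicator_of_notMem hp]
      have : kinInter (P i) (Q i) (p.1 * c) p.2 = ∅ :=
        Set.eq_empty_of_forall_notMem fun z hz => hp ⟨Set.mem_univ _,
          mem_closedBall_zero_iff.2 (norm_le_of_mem_kinInter (hRPi i) (hRQi i) hz)⟩
      rw [this, extendVal_empty, norm_zero]
  · have hI : kinInter (⋂ i, P i) (⋂ i, Q i) (p.1 * c) p.2 =
        ⋂ i, kinInter (P i) (Q i) (p.1 * c) p.2 := by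
      ext z
      simp only [mem_kinInter, Set.mem_iInter, forall_and]
    rw [hI]
    exact tendsto_extendVal_of_antitone h2
      (fun i j hij z hz => ⟨hP hij hz.1, hQ hij hz.2⟩)
      (fun i => convex_kinInter (hPc i) (hQc i) _ _)
      (fun i => isCompact_kinInter (hPk i) (hQk i).isClosed _ _)

lemma cosetKin_eq_cosetKin_one [νSU.IsHaarMeasure] (νU : Measure (Matrix.unitaryGroup (Fin n) ℂ))
    [νU.IsHaarMeasure] [IsProbabilityMeasure νU] {k : ℕ} (hk : 0 < k) (h1 : IsValuation μ)
    (h2 : Continuous μ) (h3 : TranslationInvariant μ) (h4 : UInvariant μ) (h5 : Homogeneous k μ)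
    (hKc : Convex ℝ K) (hKk : IsCompact K) (hLc : Convex ℝ L) (hLk : IsCompact L)
    (c : Matrix.unitaryGroup (Fin n) ℂ) :
    cosetKin μ νSU K L c = cosetKin μ νSU K L 1 := by
  obtain ⟨s, hsk, hs, rfl⟩ := exists_polyhedron_approx hKc hKk
  obtain ⟨t, htk, ht, rfl⟩ := exists_polyhedron_approx hLc hLk
  have h (c : Matrix.unitaryGroup (Fin n) ℂ) := tendsto_cosetKin (νSU := νSU) h2 hs
    (fun i => convex_polyhedron (s i)) hsk ht (fun i => convex_polyhedron (t i)) htk c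
  refine tendsto_nhds_unique (h c) ((h 1).congr fun i => ?_)
  exact (cosetKin_polyhedron νU hk h1 h2 h3 h4 h5 (hsk i) (htk i) c).symm

end Limit

section Conclusion

variable {n : ℕ} {μ : ConvexBody (Cn n) → ℂ} {K L : Set (Cn n)}

lemma inter_image_actU_add (K L : Set (Cn n)) (g : Matrix.unitaryGroup (Fin n) ℂ) (x : Cn n) :
    K ∩ ((fun y => actU g y + x) '' L) = kinInter K L g x := by
  ext z
  rw [mem_kinInter, Set.mem_inter_iff]
  refine and_congr_right fun _ => ⟨?_, fun h => ⟨_, h, ?_⟩⟩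
  · rintro ⟨y, hy, rfl⟩
    rwa [add_sub_cancel_right, actU_inv_actU]
  · simp only [actU_actU_inv, sub_add_cancel]

/-- Averaging the kinematic integral over the cosets of `SU(n)` gives the one over `U(n)`. -/
lemma integral_cosetKin {νSU : Measure (SUgrp n)} [IsProbabilityMeasure νSU]
    {νU : Measure (Matrix.unitaryGroup (Fin n) ℂ)} [νU.IsHaarMeasure] [IsProbabilityMeasure νU]
    (h2 : Continuous μ) (hKc : Convex ℝ K) (hKk : IsCompact K)
    (hLc : Convex ℝ L) (hLk : IsCompact L) :
    ∫ g, cosetKin μ νSU K L g ∂νU = ∫ g, (∫ x, extendVal μ (kinInter K L g x)) ∂νU := by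
  simp only [cosetKin]
  rw [integral_integral_swap]
  · have (s : SUgrp n) : ∫ g, (∫ x, extendVal μ (kinInter K L (s * g) x)) ∂νU =
        ∫ g, (∫ x, extendVal μ (kinInter K L g x)) ∂νU :=
      integral_mul_left_eq_self (fun g => ∫ x, extendVal μ (kinInter K L g x)) s.1
    simp [this]
  · exact (integrable_extendVal_kinInter h2 hKc hKk hLc hLk (νU.prod νSU)
      (φ := fun p : Matrix.unitaryGroup (Fin n) ℂ × SUgrp n => p.2 * p.1)
      (by fun_prop)).integral_prod_left

end Conclusion

end Proof

/-- For a `U(n)`-invariant valuation `μ` of positive degree, the `SU(n)`-kinematic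
integral agrees with the `U(n)`-kinematic integral. -/
theorem kinematic_formula_unitary_invariant (n : ℕ) (hn : 2 ≤ n) (k : ℕ) (hk : 0 < k)
    (μ : ConvexBody (Cn n) → ℂ)
    (h1 : IsValuation μ) (h2 : Continuous μ) (h3 : TranslationInvariant μ)
    (h4 : UInvariant μ) (h5 : Homogeneous k μ)
    (νSU : Measure ↥(SUgrp n)) (hνSU : νSU.IsHaarMeasure)
    (hνSUP : IsProbabilityMeasure νSU)
    (νU : Measure ↥(Matrix.unitaryGroup (Fin n) ℂ)) (hνU : νU.IsHaarMeasure)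
    (hνUP : IsProbabilityMeasure νU)
    (K L : ConvexBody (Cn n)) :
    (∫ g, (∫ x, extendVal μ
        ((K : Set (Cn n)) ∩ ((fun y => actSU g y + x) '' (L : Set (Cn n))))) ∂νSU)
      = ∫ g, (∫ x, extendVal μ
        ((K : Set (Cn n)) ∩ ((fun y => actU g y + x) '' (L : Set (Cn n))))) ∂νU := by
  have hKc := K.convex
  have hKk := K.isCompact
  have hLc := L.convex
  have hLk := L.isCompact
  simp only [actSU, inter_image_actU_add]
  have hone : ∫ g, (∫ x, extendVal μ (kinInter (K : Set (Cn n)) L g x)) ∂νSU =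
      cosetKin μ νSU K L 1 := by
    simp only [cosetKin, mul_one]
  rw [hone, ← integral_cosetKin (νSU := νSU) h2 hKc hKk hLc hLk]
  simp only [cosetKin_eq_cosetKin_one νU hk h1 h2 h3 h4 h5 hKc hKk hLc hLk]
  rw [integral_const, probReal_univ, one_smul]

end
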